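/- arXiv:2102.01291 — 2 statements merged into one kernel-verified Lean document; each statement's English description precedes it below -/
import Mathlib

section
/- (Lemma A1, joint asymptotic normality.) Under Assumptions 1, 2 and 3, the (M+1)-dimensional random vector √N · (θ̂₀ − θ, X̂) converges in distribution to a multivariate normal N(0, V*), where V* is the symmetric block matrix with scalar upper-left block V*_{θ̂₀} := Σ_{g∈𝒢} p_g^{-1} A_{θ,g} S*_g A_{θ,g}′ − S*_θ, off-diagonal block V*_{X̂,θ̂₀} := Σ_{g∈𝒢} p_g^{-1} A_{0,g} S*_g A_{θ,g}′ (and its transpose), and M×M lower-right block V*_{X̂} := Σ_{g∈𝒢} p_g^{-1} A_{0,g} S*_g A_{0,g}′; here S*_θ := lim_{N→∞} S_θ with S_θ := S(Σ_{g∈𝒢} A_{θ,g} Y(g)), a limit which exists under Assumption 3(ii). -/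
open Finset Filter Topology Matrix MeasureTheory ProbabilityTheory
open scoped BigOperators Classical ENNReal NNReal

noncomputable section

namespace Staggered

/-- Treatment dates: `ℕ∞ = ℕ ∪ {∞}`; `⊤` means never treated. -/
abbrev Date : Type := ℕ∞

/-- Period `t : Fin T` stands for calendar period `t + 1`; `periodLT t g` says that period `t`
is strictly earlier than the treatment date `g` (i.e. `g > t`). -/
def periodLT {T : ℕ} (t : Fin T) (g : Date) : Prop := (((t : ℕ) + 1 : ℕ) : Date) < g

/-- Assumption 1 sample space: the valid assignment vectors, i.e. those in which exactly
`Ng g` units have first-treatment date `g`, for every `g ∈ 𝒢`. -/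
def assigns (N : ℕ) (𝒢 : Finset Date) (Ng : Date → ℕ) : Finset (Fin N → 𝒢) :=
  Finset.univ.filter fun d => ∀ g ∈ 𝒢, (Finset.univ.filter fun i => (d i : Date) = g).card = Ng g

/-- Expectation under the uniform distribution on valid assignments (Assumption 1). -/
def expec (N : ℕ) (𝒢 : Finset Date) (Ng : Date → ℕ) (f : (Fin N → 𝒢) → ℝ) : ℝ :=
  (∑ d ∈ assigns N 𝒢 Ng, f d) / ((assigns N 𝒢 Ng).card : ℝ)

/-- Probability of an event under the uniform distribution on valid assignments. -/
def prob (N : ℕ) (𝒢 : Finset Date) (Ng : Date → ℕ) (p : (Fin N → 𝒢) → Prop) : ℝ :=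
  (((assigns N 𝒢 Ng).filter p).card : ℝ) / ((assigns N 𝒢 Ng).card : ℝ)

/-- Variance of a real statistic under the uniform distribution on valid assignments. -/
def varE (N : ℕ) (𝒢 : Finset Date) (Ng : Date → ℕ) (f : (Fin N → 𝒢) → ℝ) : ℝ :=
  expec N 𝒢 Ng fun d => (f d - expec N 𝒢 Ng f) ^ 2

/-- Covariance of two real statistics under the uniform distribution on valid assignments. -/
def covE (N : ℕ) (𝒢 : Finset Date) (Ng : Date → ℕ) (f h : (Fin N → 𝒢) → ℝ) : ℝ :=
  expec N 𝒢 Ng fun d => (f d - expec N 𝒢 Ng f) * (h d - expec N 𝒢 Ng h)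

/-- Observed outcome vectors `Y_i = Y_i(G_i)`. -/
def obs {N T : ℕ} {𝒢 : Finset Date} (Y : Fin N → Date → Fin T → ℝ) (d : Fin N → 𝒢) :
    Fin N → Fin T → ℝ := fun i => Y i (d i)

/-- Cohort sample mean `Ȳ_g` computed from outcome data `y` and assignment `d`. -/
def cmean {N T : ℕ} {𝒢 : Finset Date} (Ng : Date → ℕ) (y : Fin N → Fin T → ℝ)
    (d : Fin N → 𝒢) (g : Date) : Fin T → ℝ :=
  fun t => (∑ i, if (d i : Date) = g then y i t else 0) / (Ng g : ℝ)

/-- Finite-population mean of a scalar attribute. -/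
def popMeanS (N : ℕ) (w : Fin N → ℝ) : ℝ := (∑ i, w i) / (N : ℝ)

/-- Finite-population variance (normalized by `N - 1`) of a scalar attribute. -/
def popVarS (N : ℕ) (w : Fin N → ℝ) : ℝ :=
  (∑ i, (w i - popMeanS N w) ^ 2) / ((N : ℝ) - 1)

/-- Finite-population mean of a vector attribute. -/
def popMeanV (N K : ℕ) (W : Fin N → Fin K → ℝ) : Fin K → ℝ := fun k => (∑ i, W i k) / (N : ℝ)

/-- Finite-population covariance matrix (normalized by `N - 1`) of a vector attribute. -/
def popCov (N K : ℕ) (W : Fin N → Fin K → ℝ) : Matrix (Fin K) (Fin K) ℝ :=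
  Matrix.of fun k l =>
    (∑ i, (W i k - popMeanV N K W k) * (W i l - popMeanV N K W l)) / ((N : ℝ) - 1)

/-- Finite-population cross-covariance matrix of two vector attributes. -/
def popCrossCov (N K : ℕ) (W V : Fin N → Fin K → ℝ) : Matrix (Fin K) (Fin K) ℝ :=
  Matrix.of fun k l =>
    (∑ i, (W i k - popMeanV N K W k) * (V i l - popMeanV N K V l)) / ((N : ℝ) - 1)

/-- `S_g`: finite-population covariance matrix of the potential outcomes `Y(g)`. -/
def Sg (N T : ℕ) (Y : Fin N → Date → Fin T → ℝ) (g : Date) : Matrix (Fin T) (Fin T) ℝ :=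
  popCov N T fun i => Y i g

/-- `S_{gg'}`: finite-population cross-covariance of `Y(g)` and `Y(g')`. -/
def Sgg (N T : ℕ) (Y : Fin N → Date → Fin T → ℝ) (g g' : Date) : Matrix (Fin T) (Fin T) ℝ :=
  popCrossCov N T (fun i => Y i g) (fun i => Y i g')

/-- Average treatment contrast `τ_{t,gg'}`. -/
def tau (N T : ℕ) (Y : Fin N → Date → Fin T → ℝ) (t : Fin T) (g g' : Date) : ℝ :=
  (∑ i, (Y i g t - Y i g' t)) / (N : ℝ)

/-- Target parameter `θ = Σ_{t,g,g'} a_{t,gg'} τ_{t,gg'}`. -/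
def thetaParam (N T : ℕ) (𝒢 : Finset Date) (Y : Fin N → Date → Fin T → ℝ)
    (a : Fin T → Date → Date → ℝ) : ℝ :=
  ∑ t, ∑ g ∈ 𝒢, ∑ g' ∈ 𝒢, a t g g' * tau N T Y t g g'

/-- Sample analog `θ̂₀` computed from outcome data `y` and assignment `d`. -/
def thetaHat0 {N T : ℕ} (𝒢 : Finset Date) (Ng : Date → ℕ) (a : Fin T → Date → Date → ℝ)
    (y : Fin N → Fin T → ℝ) (d : Fin N → 𝒢) : ℝ :=
  ∑ t, ∑ g ∈ 𝒢, ∑ g' ∈ 𝒢, a t g g' * (cmean Ng y d g t - cmean Ng y d g' t)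

/-- The statistic `X̂` computed from outcome data `y` and assignment `d`. -/
def Xhat {N T M : ℕ} (𝒢 : Finset Date) (Ng : Date → ℕ)
    (b : Fin M → Fin T → Date → Date → ℝ) (y : Fin N → Fin T → ℝ) (d : Fin N → 𝒢) :
    Fin M → ℝ :=
  fun j => ∑ t, ∑ g ∈ 𝒢, ∑ g' ∈ 𝒢, b j t g g' * (cmean Ng y d g t - cmean Ng y d g' t)

/-- Induced row vector `A_{θ,g}` of weights on `Ȳ_g` in `θ̂₀`. -/
def Atheta (T : ℕ) (𝒢 : Finset Date) (a : Fin T → Date → Date → ℝ) (g : Date) :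
    Fin T → ℝ := fun t => ∑ g' ∈ 𝒢, (a t g g' - a t g' g)

/-- Induced `M × T` matrix `A_{0,g}` of weights on `Ȳ_g` in `X̂`. -/
def A0 (T M : ℕ) (𝒢 : Finset Date) (b : Fin M → Fin T → Date → Date → ℝ) (g : Date) :
    Matrix (Fin M) (Fin T) ℝ :=
  Matrix.of fun j t => ∑ g' ∈ 𝒢, (b j t g g' - b j t g' g)

/-- `S_θ`: finite-population variance of the unit-level scalars `Σ_g A_{θ,g} Y_i(g)`. -/
def Stheta (N T : ℕ) (𝒢 : Finset Date) (Y : Fin N → Date → Fin T → ℝ)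
    (a : Fin T → Date → Date → ℝ) : ℝ :=
  popVarS N fun i => ∑ g ∈ 𝒢, Atheta T 𝒢 a g ⬝ᵥ Y i g

/-- Within-cohort sample covariance `Ŝ_g` from outcome data `y` and assignment `d`. -/
def Shat {N T : ℕ} {𝒢 : Finset Date} (Ng : Date → ℕ) (y : Fin N → Fin T → ℝ)
    (d : Fin N → 𝒢) (g : Date) : Matrix (Fin T) (Fin T) ℝ :=
  Matrix.of fun t t' =>
    (∑ i, if (d i : Date) = g then
      (y i t - cmean Ng y d g t) * (y i t' - cmean Ng y d g t') else 0) / ((Ng g : ℝ) - 1)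

/-- Plug-in estimate `V̂_{X̂}`. -/
def VhatX {N T M : ℕ} (𝒢 : Finset Date) (Ng : Date → ℕ)
    (b : Fin M → Fin T → Date → Date → ℝ) (y : Fin N → Fin T → ℝ) (d : Fin N → 𝒢) :
    Matrix (Fin M) (Fin M) ℝ :=
  ∑ g ∈ 𝒢, ((Ng g : ℝ))⁻¹ • (A0 T M 𝒢 b g * Shat Ng y d g * (A0 T M 𝒢 b g)ᵀ)

/-- Plug-in estimate `V̂_{X̂,θ̂₀}`. -/
def VhatXtheta {N T M : ℕ} (𝒢 : Finset Date) (Ng : Date → ℕ)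
    (a : Fin T → Date → Date → ℝ) (b : Fin M → Fin T → Date → Date → ℝ)
    (y : Fin N → Fin T → ℝ) (d : Fin N → 𝒢) : Fin M → ℝ :=
  ∑ g ∈ 𝒢, ((Ng g : ℝ))⁻¹ • ((A0 T M 𝒢 b g * Shat Ng y d g).mulVec (Atheta T 𝒢 a g))

/-- Plug-in coefficient `β̂* = V̂_{X̂}⁻¹ V̂_{X̂,θ̂₀}`. -/
def betaHatStar {N T M : ℕ} (𝒢 : Finset Date) (Ng : Date → ℕ)
    (a : Fin T → Date → Date → ℝ) (b : Fin M → Fin T → Date → Date → ℝ)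
    (y : Fin N → Fin T → ℝ) (d : Fin N → 𝒢) : Fin M → ℝ :=
  (VhatX 𝒢 Ng b y d)⁻¹.mulVec (VhatXtheta 𝒢 Ng a b y d)

/-- Plug-in efficient estimator `θ̂_{β̂*} = θ̂₀ - X̂'β̂*`. -/
def thetaHatPlug {N T M : ℕ} (𝒢 : Finset Date) (Ng : Date → ℕ)
    (a : Fin T → Date → Date → ℝ) (b : Fin M → Fin T → Date → Date → ℝ)
    (y : Fin N → Fin T → ℝ) (d : Fin N → 𝒢) : ℝ :=
  thetaHat0 𝒢 Ng a y d - ∑ j, Xhat 𝒢 Ng b y d j * betaHatStar 𝒢 Ng a b y d j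

/-- Neyman-style variance estimator `σ̂*²`. -/
def sigmaSqNeyman {N T M : ℕ} (𝒢 : Finset Date) (Ng : Date → ℕ)
    (a : Fin T → Date → Date → ℝ) (b : Fin M → Fin T → Date → Date → ℝ)
    (y : Fin N → Fin T → ℝ) (d : Fin N → 𝒢) : ℝ :=
  (∑ g ∈ 𝒢, ((N : ℝ) / (Ng g : ℝ)) *
      (Atheta T 𝒢 a g ⬝ᵥ (Shat Ng y d g).mulVec (Atheta T 𝒢 a g)))
  - (∑ g ∈ 𝒢, ((N : ℝ) / (Ng g : ℝ)) •
        ((A0 T M 𝒢 b g * Shat Ng y d g).mulVec (Atheta T 𝒢 a g))) ⬝ᵥ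
    ((∑ g ∈ 𝒢, ((N : ℝ) / (Ng g : ℝ)) •
        (A0 T M 𝒢 b g * Shat Ng y d g * (A0 T M 𝒢 b g)ᵀ))⁻¹.mulVec
      (∑ g ∈ 𝒢, ((N : ℝ) / (Ng g : ℝ)) •
        ((A0 T M 𝒢 b g * Shat Ng y d g).mulVec (Atheta T 𝒢 a g))))

/-- The `(g_min - 1) × T` selection matrix `M` picking out the periods before `g_min`. -/
def Msel (T gmin : ℕ) : Matrix (Fin (gmin - 1)) (Fin T) ℝ :=
  Matrix.of fun k t => if (t : ℕ) = (k : ℕ) then 1 else 0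

/-- `β̂_g = (M Ŝ_g M')⁻¹ M Ŝ_g A_{θ,g}'`. -/
def betaHatg {N T : ℕ} {𝒢 : Finset Date} (Ng : Date → ℕ) (a : Fin T → Date → Date → ℝ)
    (gmin : ℕ) (y : Fin N → Fin T → ℝ) (d : Fin N → 𝒢) (g : Date) : Fin (gmin - 1) → ℝ :=
  (Msel T gmin * Shat Ng y d g * (Msel T gmin)ᵀ)⁻¹.mulVec
    ((Msel T gmin * Shat Ng y d g).mulVec (Atheta T 𝒢 a g))

/-- Refined variance estimator `σ̂**²`. -/
def sigmaSqRefined {N T M : ℕ} (𝒢 : Finset Date) (Ng : Date → ℕ)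
    (a : Fin T → Date → Date → ℝ) (b : Fin M → Fin T → Date → Date → ℝ) (gmin : ℕ)
    (y : Fin N → Fin T → ℝ) (d : Fin N → 𝒢) : ℝ :=
  sigmaSqNeyman 𝒢 Ng a b y d -
    (∑ g ∈ 𝒢.filter fun g => (gmin : Date) ≤ g, betaHatg Ng a gmin y d g) ⬝ᵥ
      ((Msel T gmin * Shat Ng y d (gmin : Date) * (Msel T gmin)ᵀ).mulVec
        (∑ g ∈ 𝒢.filter fun g => (gmin : Date) ≤ g, betaHatg Ng a gmin y d g))

/-- Studentized plug-in efficient statistic `t = θ̂_{β̂*} / (σ̂** / √N)`. -/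
def tstat {N T M : ℕ} (𝒢 : Finset Date) (Ng : Date → ℕ)
    (a : Fin T → Date → Date → ℝ) (b : Fin M → Fin T → Date → Date → ℝ) (gmin : ℕ)
    (y : Fin N → Fin T → ℝ) (d : Fin N → 𝒢) : ℝ :=
  thetaHatPlug 𝒢 Ng a b y d /
    (Real.sqrt (sigmaSqRefined 𝒢 Ng a b gmin y d) / Real.sqrt (N : ℝ))

/-- Fisher randomization test p-value for the statistic `stat`, based on observed data
`(Y(G), G)` and recomputing the statistic with permuted assignments. -/
def pFRT {N T : ℕ} {𝒢 : Finset Date} (stat : (Fin N → Fin T → ℝ) → (Fin N → 𝒢) → ℝ)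
    (Y : Fin N → Date → Fin T → ℝ) (d : Fin N → 𝒢) : ℝ :=
  (((Finset.univ : Finset (Equiv.Perm (Fin N))).filter fun π =>
      stat (obs Y d) (fun i => d (π i)) ≥ stat (obs Y d) d).card : ℝ) /
    ((Finset.univ : Finset (Equiv.Perm (Fin N))).card : ℝ)

/-- Limit covariance matrix `V*_{X̂}`. -/
def VstarX (T M : ℕ) (𝒢 : Finset Date) (b : Fin M → Fin T → Date → Date → ℝ)
    (p : Date → ℝ) (Sstar : Date → Matrix (Fin T) (Fin T) ℝ) : Matrix (Fin M) (Fin M) ℝ :=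
  ∑ g ∈ 𝒢, (p g)⁻¹ • (A0 T M 𝒢 b g * Sstar g * (A0 T M 𝒢 b g)ᵀ)

/-- Limit covariance vector `V*_{X̂,θ̂₀}`. -/
def VstarXtheta (T M : ℕ) (𝒢 : Finset Date) (a : Fin T → Date → Date → ℝ)
    (b : Fin M → Fin T → Date → Date → ℝ) (p : Date → ℝ)
    (Sstar : Date → Matrix (Fin T) (Fin T) ℝ) : Fin M → ℝ :=
  ∑ g ∈ 𝒢, (p g)⁻¹ • ((A0 T M 𝒢 b g * Sstar g).mulVec (Atheta T 𝒢 a g))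

/-- Limit variance `V*_{θ̂₀}`. -/
def VstarTheta (T : ℕ) (𝒢 : Finset Date) (a : Fin T → Date → Date → ℝ) (p : Date → ℝ)
    (Sstar : Date → Matrix (Fin T) (Fin T) ℝ) (Sthetastar : ℝ) : ℝ :=
  (∑ g ∈ 𝒢, (p g)⁻¹ * (Atheta T 𝒢 a g ⬝ᵥ (Sstar g).mulVec (Atheta T 𝒢 a g))) - Sthetastar

/-- Asymptotic variance `σ*²` of the (plug-in) efficient estimator. -/
def sigmaSqLim (T M : ℕ) (𝒢 : Finset Date) (a : Fin T → Date → Date → ℝ)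
    (b : Fin M → Fin T → Date → Date → ℝ) (p : Date → ℝ)
    (Sstar : Date → Matrix (Fin T) (Fin T) ℝ) (Sthetastar : ℝ) : ℝ :=
  VstarTheta T 𝒢 a p Sstar Sthetastar -
    VstarXtheta T M 𝒢 a b p Sstar ⬝ᵥ
      (VstarX T M 𝒢 b p Sstar)⁻¹.mulVec (VstarXtheta T M 𝒢 a b p Sstar)

/-- A bounded real function. -/
def IsBounded (f : ℝ → ℝ) : Prop := ∃ C, ∀ x, |f x| ≤ C

end Staggered

namespace Staggered
section CombCLT

variable {ι κ : Type*} [Fintype ι] [DecidableEq ι] [Fintype κ]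

/-- linear statistic -/
def linStat (b : ι → κ → ℝ) (d : ι → κ) : ℝ := ∑ i, b i (d i)

/-- A finite set of assignments closed under swaps, with prescribed cohort sizes. -/
structure SwapInv (A : Finset (ι → κ)) (n : κ → ℝ) : Prop where
  ne : A.Nonempty
  swap : ∀ d ∈ A, ∀ i j, d ∘ Equiv.swap i j ∈ A
  cnt : ∀ d ∈ A, ∀ h : κ → ℝ, ∑ i, h (d i) = ∑ g, n g * h g
  nonneg : ∀ g, 0 ≤ n g
  tot : ∑ g, n g = (Fintype.card ι : ℝ)

lemma SwapInv.sum_swap {A : Finset (ι → κ)} {n : κ → ℝ} (hA : SwapInv A n)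
    {E : Type*} [AddCommMonoid E] (F : (ι → κ) → E) (i j : ι) :
    ∑ d ∈ A, F (d ∘ Equiv.swap i j) = ∑ d ∈ A, F d := by
  refine Finset.sum_bij' (fun d _ => d ∘ Equiv.swap i j) (fun d _ => d ∘ Equiv.swap i j)
    (fun d hd => hA.swap d hd i j) (fun d hd => hA.swap d hd i j) ?_ ?_ ?_
  · intro d _; ext x; simp
  · intro d _; ext x; simp
  · intro d _; rfl

lemma linStat_swap (b : ι → κ → ℝ) (d : ι → κ) (i j : ι) :
    linStat b d - linStat b (d ∘ Equiv.swap i j)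
      = b i (d i) + b j (d j) - b i (d j) - b j (d i) := by
  unfold linStat
  rw [← Finset.sum_sub_distrib]
  by_cases hij : i = j
  · subst hij; simp
  · rw [Finset.sum_eq_add i j hij]
    · simp; ring
    · intro c _ hc
      simp [Equiv.swap_apply_of_ne_of_ne hc.1 hc.2]
    · simp
    · simp

lemma SwapInv.stein {A : Finset (ι → κ)} {n : κ → ℝ} (hA : SwapInv A n) (b : ι → κ → ℝ)
    (hrow : ∀ i, ∑ g, n g * b i g = 0)
    {E : Type*} [AddCommGroup E] [Module ℝ E] (F : (ι → κ) → E) :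
    (Fintype.card ι : ℝ) • ∑ d ∈ A, linStat b d • F d
      = ∑ d ∈ A, ∑ i, ∑ j, b i (d i) • (F d - F (d ∘ Equiv.swap i j)) := by
  have h2 : ∑ d ∈ A, ∑ i, ∑ j, b i (d i) • F (d ∘ Equiv.swap i j) = 0 := by
    rw [Finset.sum_comm]
    refine Finset.sum_eq_zero fun i _ => ?_
    rw [Finset.sum_comm]
    have : ∀ j, ∑ d ∈ A, b i (d i) • F (d ∘ Equiv.swap i j) = ∑ d ∈ A, b i (d j) • F d := by
      intro j
      rw [← hA.sum_swap (fun d => b i (d j) • F d) i j]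
      simp
    simp_rw [this]
    rw [Finset.sum_comm]
    refine Finset.sum_eq_zero fun d hd => ?_
    rw [← Finset.sum_smul, hA.cnt d hd (b i), hrow, zero_smul]
  simp_rw [smul_sub, Finset.sum_sub_distrib]
  rw [h2, sub_zero, Finset.smul_sum]
  refine Finset.sum_congr rfl fun d _ => ?_
  simp only [linStat, Finset.sum_smul, Finset.sum_const, Finset.card_univ, Finset.smul_sum]
  refine Finset.sum_congr rfl fun i _ => ?_
  rw [Nat.cast_smul_eq_nsmul]

lemma SwapInv.marginal {A : Finset (ι → κ)} {n : κ → ℝ} (hA : SwapInv A n) (h : κ → ℝ) (i : ι) :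
    (Fintype.card ι : ℝ) * ∑ d ∈ A, h (d i) = (A.card : ℝ) * ∑ g, n g * h g := by
  have : ∀ j, ∑ d ∈ A, h (d i) = ∑ d ∈ A, h (d j) := by
    intro j
    rw [← hA.sum_swap (fun d => h (d j)) i j]
    simp
  calc (Fintype.card ι : ℝ) * ∑ d ∈ A, h (d i) = ∑ j : ι, ∑ d ∈ A, h (d i) := by simp
    _ = ∑ j : ι, ∑ d ∈ A, h (d j) := Finset.sum_congr rfl fun j _ => this j
    _ = ∑ d ∈ A, ∑ j : ι, h (d j) := Finset.sum_comm
    _ = ∑ d ∈ A, ∑ g, n g * h g := Finset.sum_congr rfl fun d hd => hA.cnt d hd h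
    _ = _ := by simp

lemma SwapInv.quad {A : Finset (ι → κ)} {n : κ → ℝ} (hA : SwapInv A n) (b : ι → κ → ℝ)
    (hrow : ∀ i, ∑ g, n g * b i g = 0) (hcol : ∀ g, ∑ i, b i g = 0) (d : ι → κ) (hd : d ∈ A) :
    ∑ i, ∑ j, b i (d i) * (linStat b d - linStat b (d ∘ Equiv.swap i j))
      = (Fintype.card ι : ℝ) * linStat (fun i g => b i g ^ 2) d + linStat b d ^ 2 := by
  simp_rw [linStat_swap, ← Finset.mul_sum, Finset.sum_sub_distrib, Finset.sum_add_distrib]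
  simp_rw [hcol, hA.cnt d hd (b _), hrow]
  simp only [Finset.sum_const, Finset.card_univ, nsmul_eq_mul, sub_zero, mul_add,
    Finset.sum_add_distrib, linStat, Finset.mul_sum]
  rw [sq, Finset.sum_mul]
  simp_rw [Finset.mul_sum]
  congr 1
  · refine Finset.sum_congr rfl fun i _ => by ring

lemma SwapInv.second {A : Finset (ι → κ)} {n : κ → ℝ} (hA : SwapInv A n) (b : ι → κ → ℝ)
    (hrow : ∀ i, ∑ g, n g * b i g = 0) (hcol : ∀ g, ∑ i, b i g = 0) :
    ((Fintype.card ι : ℝ) - 1) * ∑ d ∈ A, linStat b d ^ 2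
      = (A.card : ℝ) * ∑ i, ∑ g, n g * b i g ^ 2 := by
  have h1 := hA.stein b hrow (linStat b)
  simp only [smul_eq_mul] at h1
  rw [Finset.sum_congr rfl fun d hd => hA.quad b hrow hcol d hd, Finset.sum_add_distrib,
    ← Finset.mul_sum] at h1
  have h2 : (Fintype.card ι : ℝ) * ∑ d ∈ A, linStat (fun i g => b i g ^ 2) d
      = (A.card : ℝ) * ∑ i, ∑ g, n g * b i g ^ 2 := by
    unfold linStat
    rw [Finset.sum_comm, Finset.mul_sum, Finset.mul_sum]
    exact Finset.sum_congr rfl fun i _ => hA.marginal (fun g => b i g ^ 2) i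
  rw [h2] at h1
  simp_rw [← sq] at h1
  linarith

lemma center_le {α : Type*} [Fintype α] (w x : α → ℝ) (S : ℝ) (hS : 0 < S)
    (hw : ∑ a, w a = S) :
    ∑ a, w a * (x a - (∑ a, w a * x a) / S) ^ 2 ≤ ∑ a, w a * x a ^ 2 := by
  set m := (∑ a, w a * x a) / S with hm
  have h1 : ∑ a, w a * x a = S * m := by rw [hm]; field_simp
  have : ∑ a, w a * (x a - m) ^ 2 = ∑ a, w a * x a ^ 2 - 2 * m * ∑ a, w a * x a
      + m ^ 2 * ∑ a, w a := by
    rw [Finset.mul_sum, Finset.mul_sum, ← Finset.sum_sub_distrib, ← Finset.sum_add_distrib]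
    exact Finset.sum_congr rfl fun a _ => by ring
  rw [this, h1, hw]
  nlinarith [mul_nonneg hS.le (sq_nonneg m)]

lemma SwapInv.varBound {A : Finset (ι → κ)} {n : κ → ℝ} (hA : SwapInv A n)
    (hcard : 2 ≤ Fintype.card ι) (h : ι → κ → ℝ) :
    ((Fintype.card ι : ℝ) - 1) *
      ∑ d ∈ A, (linStat h d - (∑ i, ∑ g, n g * h i g) / (Fintype.card ι : ℝ)) ^ 2
      ≤ (A.card : ℝ) * ∑ i, ∑ g, n g * h i g ^ 2 := by
  set N : ℝ := (Fintype.card ι : ℝ) with hN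
  have hN2 : (2 : ℝ) ≤ N := by rw [hN]; exact_mod_cast hcard
  have hN0 : 0 < N := by linarith
  set h1 : ι → κ → ℝ := fun i g => h i g - (∑ g, n g * h i g) / N with hh1
  set h2 : ι → κ → ℝ := fun i g => h1 i g - (∑ i, 1 * h1 i g) / N with hh2
  have r1 : ∀ i, ∑ g, n g * h1 i g = 0 := by
    intro i
    simp only [hh1, mul_sub, Finset.sum_sub_distrib, ← Finset.sum_mul, hA.tot]
    rw [← hN]; field_simp; ring
  have c2 : ∀ g, ∑ i, h2 i g = 0 := by
    intro g
    simp only [hh2, Finset.sum_sub_distrib, Finset.sum_const, Finset.card_univ, nsmul_eq_mul,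
      one_mul]
    rw [← hN]; field_simp; ring
  have e2 : ∑ g, n g * (∑ i, 1 * h1 i g) / N = 0 := by
    rw [← Finset.sum_div]
    simp_rw [Finset.mul_sum]
    rw [Finset.sum_comm]
    simp [r1]
  have r2 : ∀ i, ∑ g, n g * h2 i g = 0 := by
    intro i
    simp only [hh2, mul_sub, Finset.sum_sub_distrib, r1]
    simp_rw [mul_div_assoc] at e2
    rw [e2]; simp
  have key := hA.second h2 r2 c2
  have e3 : ∀ d ∈ A, linStat h2 d = linStat h d - (∑ i, ∑ g, n g * h i g) / N := by
    intro d hd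
    simp only [linStat, hh2, Finset.sum_sub_distrib]
    rw [hA.cnt d hd (fun g => (∑ i, 1 * h1 i g) / N)]
    simp_rw [← mul_div_assoc]
    rw [e2]
    simp only [hh1, Finset.sum_sub_distrib, Finset.sum_div, sub_zero]
  rw [Finset.sum_congr rfl fun d hd => by rw [e3 d hd]] at key
  rw [← hN] at key
  rw [key]
  refine mul_le_mul_of_nonneg_left ?_ (by positivity)
  calc ∑ i, ∑ g, n g * h2 i g ^ 2 = ∑ g, n g * ∑ i, 1 * h2 i g ^ 2 := by
        rw [Finset.sum_comm]; simp [Finset.mul_sum]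
    _ ≤ ∑ g, n g * ∑ i, 1 * h1 i g ^ 2 := by
        refine Finset.sum_le_sum fun g _ => mul_le_mul_of_nonneg_left ?_ (hA.nonneg g)
        exact center_le (fun _ : ι => (1 : ℝ)) (fun i => h1 i g) N hN0 (by simp [hN])
    _ = ∑ i, ∑ g, n g * h1 i g ^ 2 := by
        rw [Finset.sum_comm]; simp [Finset.mul_sum]
    _ ≤ _ := Finset.sum_le_sum fun i _ => center_le n (fun g => h i g) N hN0 hA.tot

lemma exp_taylor2 (x : ℝ) :
    ‖Complex.exp (Complex.I * x) - 1 - Complex.I * x‖ ≤ x ^ 2 := by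
  have hd : ∀ y ∈ Set.Icc (-|x|) |x|, HasDerivWithinAt
      (fun y : ℝ => Complex.exp (Complex.I * y) - 1 - Complex.I * y)
      (Complex.I * (Complex.exp (Complex.I * y) - 1)) (Set.Icc (-|x|) |x|) y := by
    intro y _
    have h0 : HasDerivAt (fun y : ℝ => Complex.I * (y : ℂ)) (Complex.I * 1) y :=
      (Complex.ofRealCLM.hasDerivAt (x := y)).const_mul Complex.I
    have h1 := (h0.cexp.sub_const 1).sub h0
    refine (h1.congr_deriv ?_).hasDerivWithinAt
    ring
  have := (convex_Icc (-|x|) |x|).norm_image_sub_le_of_norm_hasDerivWithin_le (C := |x|) hd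
    (fun y hy => by
      rw [norm_mul, Complex.norm_I, one_mul]
      refine Real.norm_exp_I_mul_ofReal_sub_one_le.trans ?_
      rw [Real.norm_eq_abs]; exact abs_le.2 hy)
    (x := 0) (y := x) (by simp) (by simp [neg_abs_le, le_abs_self])
  simpa [← sq] using this

lemma SwapInv.steinBound {A : Finset (ι → κ)} {n : κ → ℝ} (hA : SwapInv A n)
    (hcard : 2 ≤ Fintype.card ι) (b : ι → κ → ℝ)
    (hrow : ∀ i, ∑ g, n g * b i g = 0) (hcol : ∀ g, ∑ i, b i g = 0)
    (ε : ℝ) (hε : 0 < ε) (hb : ∀ i g, |b i g| ≤ ε) (v : ℝ)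
    (hv : v = (∑ i, ∑ g, n g * b i g ^ 2) / (Fintype.card ι : ℝ)) (s : ℝ) :
    ‖∑ d ∈ A, (linStat b d : ℂ) * Complex.exp (Complex.I * ((s * linStat b d : ℝ) : ℂ))
      - Complex.I * s * v * ∑ d ∈ A, Complex.exp (Complex.I * ((s * linStat b d : ℝ) : ℂ))‖
      ≤ (A.card : ℝ) * (|s| * (ε * (1 / 2 + v) + 2 * v / (Fintype.card ι : ℝ))
        + 16 * s ^ 2 * ε * v) := by
  set N : ℝ := (Fintype.card ι : ℝ) with hN
  have hN2 : (2 : ℝ) ≤ N := by rw [hN]; exact_mod_cast hcard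
  have hN0 : 0 < N := by linarith
  have hvN : ∑ i, ∑ g, n g * b i g ^ 2 = N * v := by
    rw [hv, mul_div_cancel₀ _ hN0.ne']
  have hv0 : 0 ≤ v := by
    rw [hv]
    refine div_nonneg (Finset.sum_nonneg fun i _ => Finset.sum_nonneg fun g _ =>
      mul_nonneg (hA.nonneg g) (sq_nonneg _)) hN0.le
  clear hv
  set W := linStat b with hW
  set L := linStat (fun i g => b i g ^ 2) with hL
  set F : (ι → κ) → ℂ := fun d => Complex.exp (Complex.I * ((s * W d : ℝ) : ℂ)) with hF
  have hFn : ∀ d, ‖F d‖ = 1 := fun d => by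
    simp only [hF]; rw [mul_comm]; exact Complex.norm_exp_ofReal_mul_I _
  -- second moment of W
  have hW2 : ∑ d ∈ A, W d ^ 2 ≤ (A.card : ℝ) * (2 * v) := by
    have h := hA.second b hrow hcol
    rw [← hN, hvN] at h
    have h0 : 0 ≤ ∑ d ∈ A, W d ^ 2 := Finset.sum_nonneg fun _ _ => sq_nonneg _
    have h1 : 0 ≤ (A.card : ℝ) * v := by positivity
    by_contra hc
    push Not at hc
    nlinarith
  have hLsum : ∑ d ∈ A, L d = (A.card : ℝ) * v := by
    have h2 : N * ∑ d ∈ A, L d = (A.card : ℝ) * ∑ i, ∑ g, n g * b i g ^ 2 := by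
      simp only [hL]
      unfold linStat
      rw [Finset.sum_comm, Finset.mul_sum, Finset.mul_sum]
      exact Finset.sum_congr rfl fun i _ => hA.marginal (fun g => b i g ^ 2) i
    rw [hvN] at h2
    have : N * ∑ d ∈ A, L d = N * ((A.card : ℝ) * v) := by rw [h2]; ring
    exact mul_left_cancel₀ hN0.ne' this
  have hLvar : ∑ d ∈ A, (L d - v) ^ 2 ≤ (A.card : ℝ) * (2 * ε ^ 2 * v) := by
    have h := hA.varBound hcard (fun i g => b i g ^ 2)
    rw [← hN, hvN, mul_div_cancel_left₀ _ hN0.ne'] at h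
    have h4 : ∑ i, ∑ g, n g * (b i g ^ 2) ^ 2 ≤ ε ^ 2 * (N * v) := by
      rw [← hvN, Finset.mul_sum]
      refine Finset.sum_le_sum fun i _ => ?_
      rw [Finset.mul_sum]
      refine Finset.sum_le_sum fun g _ => ?_
      have hb2 : b i g ^ 2 ≤ ε ^ 2 := sq_le_sq' (abs_le.1 (hb i g)).1 (abs_le.1 (hb i g)).2
      have := mul_le_mul_of_nonneg_right hb2 (mul_nonneg (hA.nonneg g) (sq_nonneg (b i g)))
      nlinarith [this]
    have h5 := mul_le_mul_of_nonneg_left h4 (Nat.cast_nonneg (α := ℝ) A.card)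
    have h6 := h.trans h5
    have h1 : 0 ≤ (A.card : ℝ) * (ε ^ 2 * v) := by positivity
    have h0 : 0 ≤ ∑ d ∈ A, (L d - v) ^ 2 := Finset.sum_nonneg fun _ _ => sq_nonneg _
    by_contra hc
    push Not at hc
    change (N - 1) * ∑ d ∈ A, (L d - v) ^ 2 ≤ _ at h6
    nlinarith
  have hLabs : ∑ d ∈ A, |L d - v| ≤ (A.card : ℝ) * (ε * (1 / 2 + v)) := by
    calc ∑ d ∈ A, |L d - v| ≤ ∑ d ∈ A, (ε / 2 + (1 / (2 * ε)) * (L d - v) ^ 2) := by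
          refine Finset.sum_le_sum fun d _ => ?_
          have h := sq_nonneg (|L d - v| - ε)
          rw [sub_sq, sq_abs] at h
          have : |L d - v| * (2 * ε) ≤ ε ^ 2 + (L d - v) ^ 2 := by linarith
          rw [← sub_nonneg]
          have e : ε / 2 + 1 / (2 * ε) * (L d - v) ^ 2 - |L d - v|
            = (ε ^ 2 + (L d - v) ^ 2 - |L d - v| * (2 * ε)) / (2 * ε) := by field_simp
          rw [e]
          exact div_nonneg (by linarith) (by positivity)
      _ = (A.card : ℝ) * (ε / 2) + (1 / (2 * ε)) * ∑ d ∈ A, (L d - v) ^ 2 := by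
          rw [Finset.sum_add_distrib, ← Finset.mul_sum]; simp
      _ ≤ (A.card : ℝ) * (ε / 2) + (1 / (2 * ε)) * ((A.card : ℝ) * (2 * ε ^ 2 * v)) := by
          gcongr
      _ = _ := by field_simp
  -- sum of squared increments
  have hD : ∑ d ∈ A, ∑ i, ∑ j, (W d - W (d ∘ Equiv.swap i j)) ^ 2
      ≤ 16 * N * ((A.card : ℝ) * v) := by
    have h1 : ∀ d ∈ A, ∑ i, ∑ j, (W d - W (d ∘ Equiv.swap i j)) ^ 2
        ≤ 8 * N * L d + 8 * (N * v) := by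
      intro d hd
      calc ∑ i, ∑ j, (W d - W (d ∘ Equiv.swap i j)) ^ 2
          ≤ ∑ i, ∑ j, (4 * b i (d i) ^ 2 + 4 * b j (d j) ^ 2 + 4 * b i (d j) ^ 2
              + 4 * b j (d i) ^ 2) := by
            refine Finset.sum_le_sum fun i _ => Finset.sum_le_sum fun j _ => ?_
            rw [hW, linStat_swap]
            nlinarith [sq_nonneg (b i (d i) - b j (d j)), sq_nonneg (b i (d i) + b i (d j)),
              sq_nonneg (b i (d i) + b j (d i)), sq_nonneg (b j (d j) + b i (d j)),
              sq_nonneg (b j (d j) + b j (d i)), sq_nonneg (b i (d j) - b j (d i))]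
        _ = 8 * N * L d + 8 * ∑ i, ∑ j, b i (d j) ^ 2 := by
            simp only [Finset.sum_add_distrib, ← Finset.mul_sum, Finset.sum_const,
              Finset.card_univ, nsmul_eq_mul]
            rw [← hN]
            have : ∑ i, ∑ j, b j (d i) ^ 2 = ∑ i, ∑ j, b i (d j) ^ 2 := Finset.sum_comm
            rw [this]
            simp only [hL, linStat]
            ring
        _ = _ := by
            rw [← hvN]
            congr 2
            exact Finset.sum_congr rfl fun i _ => hA.cnt d hd (fun g => b i g ^ 2)
    refine (Finset.sum_le_sum h1).trans ?_
    rw [Finset.sum_add_distrib, ← Finset.mul_sum, hLsum]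
    simp
    nlinarith
  -- expansion
  have hst := hA.stein b hrow F
  have hexp : ∀ d i j, F d - F (d ∘ Equiv.swap i j)
      = F d * (Complex.I * s * ((W d - W (d ∘ Equiv.swap i j) : ℝ) : ℂ))
        - F d * (Complex.exp (Complex.I * ((-(s * (W d - W (d ∘ Equiv.swap i j))) : ℝ) : ℂ)) - 1
          - Complex.I * ((-(s * (W d - W (d ∘ Equiv.swap i j))) : ℝ) : ℂ)) := by
    intro d i j
    have : F (d ∘ Equiv.swap i j) = F d *
        Complex.exp (Complex.I * ((-(s * (W d - W (d ∘ Equiv.swap i j))) : ℝ) : ℂ)) := by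
      simp only [hF]
      rw [← Complex.exp_add]
      congr 1
      push_cast
      ring
    rw [this]
    push_cast
    ring
  set R : (ι → κ) → ι → ι → ℂ := fun d i j =>
    F d * (Complex.exp (Complex.I * ((-(s * (W d - W (d ∘ Equiv.swap i j))) : ℝ) : ℂ)) - 1
          - Complex.I * ((-(s * (W d - W (d ∘ Equiv.swap i j))) : ℝ) : ℂ)) with hR
  have hRn : ∀ d i j, ‖R d i j‖ ≤ s ^ 2 * (W d - W (d ∘ Equiv.swap i j)) ^ 2 := by
    intro d i j
    simp only [hR]
    rw [norm_mul, hFn, one_mul]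
    refine (exp_taylor2 _).trans (le_of_eq ?_)
    ring
  have hmain : (N : ℂ) * (∑ d ∈ A, (W d : ℂ) * F d - Complex.I * s * v * ∑ d ∈ A, F d)
      = ∑ d ∈ A, F d * (Complex.I * s) * ((N * (L d - v) + W d ^ 2 : ℝ) : ℂ)
        - ∑ d ∈ A, ∑ i, ∑ j, (b i (d i) : ℂ) * R d i j := by
    have e1 : (N : ℂ) * ∑ d ∈ A, (W d : ℂ) * F d
        = ∑ d ∈ A, F d * (Complex.I * s) * ((N * L d + W d ^ 2 : ℝ) : ℂ)
        - ∑ d ∈ A, ∑ i, ∑ j, (b i (d i) : ℂ) * R d i j := by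
      have e0 : (N : ℂ) * ∑ d ∈ A, (W d : ℂ) * F d = N • ∑ d ∈ A, W d • F d := by
        simp [Complex.real_smul]
      rw [e0, hst, ← Finset.sum_sub_distrib]
      refine Finset.sum_congr rfl fun d hd => ?_
      rw [← hA.quad b hrow hcol d hd]
      simp_rw [hexp]
      push_cast
      rw [Finset.mul_sum, ← Finset.sum_sub_distrib]
      refine Finset.sum_congr rfl fun i _ => ?_
      rw [Finset.mul_sum, ← Finset.sum_sub_distrib]
      refine Finset.sum_congr rfl fun j _ => ?_
      rw [Complex.real_smul]
      simp only [hR]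
      push_cast
      ring
    rw [mul_sub, e1, Finset.mul_sum, Finset.mul_sum, sub_right_comm, ← Finset.sum_sub_distrib]
    congr 1
    refine Finset.sum_congr rfl fun d _ => ?_
    push_cast
    ring
  have hb1 : ‖∑ d ∈ A, F d * (Complex.I * s) * ((N * (L d - v) + W d ^ 2 : ℝ) : ℂ)‖
      ≤ |s| * (N * ((A.card : ℝ) * (ε * (1 / 2 + v))) + (A.card : ℝ) * (2 * v)) := by
    calc _ ≤ ∑ d ∈ A, |s| * (N * |L d - v| + W d ^ 2) := by
          refine norm_sum_le_of_le _ fun d _ => ?_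
          rw [norm_mul, norm_mul, norm_mul, hFn, Complex.norm_I, Complex.norm_real,
            Complex.norm_real, one_mul, one_mul, Real.norm_eq_abs, Real.norm_eq_abs]
          refine mul_le_mul_of_nonneg_left ?_ (abs_nonneg _)
          refine (abs_add_le _ _).trans ?_
          rw [abs_mul, abs_of_pos hN0, abs_of_nonneg (sq_nonneg (W d))]
      _ = |s| * (N * ∑ d ∈ A, |L d - v| + ∑ d ∈ A, W d ^ 2) := by
          rw [← Finset.mul_sum, Finset.sum_add_distrib, ← Finset.mul_sum]
      _ ≤ _ := by gcongr
  have hb2 : ‖∑ d ∈ A, ∑ i, ∑ j, (b i (d i) : ℂ) * R d i j‖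
      ≤ ε * s ^ 2 * (16 * N * ((A.card : ℝ) * v)) := by
    calc _ ≤ ∑ d ∈ A, ∑ i, ∑ j, ε * s ^ 2 * (W d - W (d ∘ Equiv.swap i j)) ^ 2 := by
          refine norm_sum_le_of_le _ fun d _ => norm_sum_le_of_le _ fun i _ =>
            norm_sum_le_of_le _ fun j _ => ?_
          rw [norm_mul, Complex.norm_real, Real.norm_eq_abs, mul_assoc]
          exact mul_le_mul (hb _ _) (hRn d i j) (norm_nonneg _) hε.le
      _ = ε * s ^ 2 * ∑ d ∈ A, ∑ i, ∑ j, (W d - W (d ∘ Equiv.swap i j)) ^ 2 := by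
          simp_rw [Finset.mul_sum]
      _ ≤ _ := by gcongr
  have hfin := (norm_sub_le _ _).trans (add_le_add hb1 hb2)
  rw [← hmain, norm_mul, Complex.norm_real, Real.norm_eq_abs, abs_of_pos hN0] at hfin
  refine le_of_mul_le_mul_left (hfin.trans (le_of_eq ?_)) hN0
  field_simp

lemma SwapInv.charBound {A : Finset (ι → κ)} {n : κ → ℝ} (hA : SwapInv A n)
    (hcard : 2 ≤ Fintype.card ι) (b : ι → κ → ℝ)
    (hrow : ∀ i, ∑ g, n g * b i g = 0) (hcol : ∀ g, ∑ i, b i g = 0)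
    (ε : ℝ) (hε : 0 < ε) (hb : ∀ i g, |b i g| ≤ ε) (v : ℝ)
    (hv : v = (∑ i, ∑ g, n g * b i g ^ 2) / (Fintype.card ι : ℝ)) (t : ℝ) :
    ‖(A.card : ℂ)⁻¹ * ∑ d ∈ A, Complex.exp (Complex.I * ((t * linStat b d : ℝ) : ℂ))
      - Complex.exp ((-(v * t ^ 2 / 2) : ℝ) : ℂ)‖
      ≤ (|t| * (ε * (1 / 2 + v) + 2 * v / (Fintype.card ι : ℝ))
        + 16 * t ^ 2 * ε * v) * |t| := by
  have hv0 : 0 ≤ v := by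
    rw [hv]
    refine div_nonneg (Finset.sum_nonneg fun i _ => Finset.sum_nonneg fun g _ =>
      mul_nonneg (hA.nonneg g) (sq_nonneg _)) (by positivity)
  have hA0 : (0 : ℝ) < A.card := by exact_mod_cast hA.ne.card_pos
  have hA0' : (A.card : ℂ) ≠ 0 := by exact_mod_cast hA0.ne'
  set C : ℝ := |t| * (ε * (1 / 2 + v) + 2 * v / (Fintype.card ι : ℝ)) + 16 * t ^ 2 * ε * v
    with hC
  have hC0 : 0 ≤ C := by positivity
  set W := linStat b with hW
  set φ : ℝ → ℂ := fun s => (A.card : ℂ)⁻¹ *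
    ∑ d ∈ A, Complex.exp (Complex.I * ((s * W d : ℝ) : ℂ)) with hφ
  set φ' : ℝ → ℂ := fun s => (A.card : ℂ)⁻¹ *
    ∑ d ∈ A, Complex.exp (Complex.I * ((s * W d : ℝ) : ℂ)) * (Complex.I * W d) with hφ'
  have hder : ∀ s, HasDerivAt φ (φ' s) s := by
    intro s
    refine HasDerivAt.const_mul _ (HasDerivAt.fun_sum fun d _ => ?_)
    refine HasDerivAt.cexp ?_
    have h0 : HasDerivAt (fun y : ℝ => ((y * W d : ℝ) : ℂ)) ((1 * W d : ℝ) : ℂ) s :=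
      ((hasDerivAt_id s).mul_const (W d)).ofReal_comp
    simpa using h0.const_mul Complex.I
  set ψ : ℝ → ℂ := fun s => φ s * Complex.exp ((v * s ^ 2 / 2 : ℝ) : ℂ) with hψ
  have hderψ : ∀ s, HasDerivAt ψ ((φ' s + s * v * φ s) *
      Complex.exp ((v * s ^ 2 / 2 : ℝ) : ℂ)) s := by
    intro s
    have h0 : HasDerivAt (fun y : ℝ => ((v * y ^ 2 / 2 : ℝ) : ℂ)) ((s * v : ℝ) : ℂ) s := by
      refine HasDerivAt.ofReal_comp ?_
      have := (((hasDerivAt_id s).pow 2).const_mul v).div_const 2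
      refine this.congr_deriv ?_
      simp
      ring
    refine ((hder s).mul h0.cexp).congr_deriv ?_
    push_cast
    ring
  have hbd : ∀ s ∈ Set.Icc (-|t|) |t|, ‖(φ' s + s * v * φ s) *
      Complex.exp ((v * s ^ 2 / 2 : ℝ) : ℂ)‖ ≤ C * Real.exp (v * t ^ 2 / 2) := by
    intro s hs
    have hst : |s| ≤ |t| := abs_le.2 hs
    have hst2 : s ^ 2 ≤ t ^ 2 := sq_le_sq.2 hst
    rw [norm_mul, Complex.norm_exp, Complex.ofReal_re]
    refine mul_le_mul ?_ (Real.exp_le_exp.2 (by gcongr)) (Real.exp_pos _).le hC0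
    have e : φ' s + s * v * φ s = Complex.I * ((A.card : ℂ)⁻¹ *
        (∑ d ∈ A, (W d : ℂ) * Complex.exp (Complex.I * ((s * W d : ℝ) : ℂ))
      - Complex.I * s * v * ∑ d ∈ A, Complex.exp (Complex.I * ((s * W d : ℝ) : ℂ)))) := by
      simp only [hφ, hφ']
      have : ∑ d ∈ A, Complex.exp (Complex.I * ((s * W d : ℝ) : ℂ)) * (Complex.I * W d)
        = Complex.I * ∑ d ∈ A, (W d : ℂ) * Complex.exp (Complex.I * ((s * W d : ℝ) : ℂ)) := by
        rw [Finset.mul_sum]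
        exact Finset.sum_congr rfl fun d _ => by ring
      rw [this]
      linear_combination ((A.card : ℂ)⁻¹ * s * v *
        ∑ d ∈ A, Complex.exp (Complex.I * ((s * W d : ℝ) : ℂ))) * (Complex.I_sq)
    rw [e, norm_mul, Complex.norm_I, one_mul, norm_mul, norm_inv, Complex.norm_natCast]
    rw [inv_mul_le_iff₀ hA0]
    refine (hA.steinBound hcard b hrow hcol ε hε hb v hv s).trans ?_
    rw [hC]
    gcongr
  have hmv := (convex_Icc (-|t|) |t|).norm_image_sub_le_of_norm_hasDerivWithin_le
    (fun s _ => (hderψ s).hasDerivWithinAt) hbd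
    (x := 0) (y := t) (by simp) (by simp [neg_abs_le, le_abs_self])
  have hψ0 : ψ 0 = 1 := by simp [hψ, hφ, hA0']
  rw [hψ0, sub_zero, Real.norm_eq_abs] at hmv
  have e2 : φ t - Complex.exp ((-(v * t ^ 2 / 2) : ℝ) : ℂ)
      = (ψ t - 1) * Complex.exp ((-(v * t ^ 2 / 2) : ℝ) : ℂ) := by
    simp only [hψ]
    rw [sub_mul, mul_assoc, ← Complex.exp_add]
    simp
  change ‖φ t - _‖ ≤ _
  rw [e2, norm_mul, Complex.norm_exp, Complex.ofReal_re]
  refine (mul_le_mul_of_nonneg_right hmv (Real.exp_pos _).le).trans (le_of_eq ?_)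
  have : Real.exp (v * t ^ 2 / 2) * Real.exp (-(v * t ^ 2 / 2)) = 1 := by
    rw [← Real.exp_add]; simp
  linear_combination C * |t| * this

end CombCLT

/-- Combinatorial central limit theorem. -/
theorem combCLT {κ : Type*} [Fintype κ] (N : ℕ → ℕ) (hN2 : ∀ m, 2 ≤ N m)
    (hN : Tendsto N atTop atTop)
    (A : ∀ m, Finset (Fin (N m) → κ)) (n : ℕ → κ → ℝ) (hA : ∀ m, SwapInv (A m) (n m))
    (b : ∀ m, Fin (N m) → κ → ℝ) (hrow : ∀ m i, ∑ g, n m g * b m i g = 0)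
    (hcol : ∀ m g, ∑ i, b m i g = 0)
    (hsmall : ∀ ε > (0 : ℝ), ∀ᶠ m in atTop, ∀ i g, |b m i g| ≤ ε) (σ2 : ℝ)
    (hσ : Tendsto (fun m => (∑ i, ∑ g, n m g * b m i g ^ 2) / (N m : ℝ)) atTop (𝓝 σ2))
    (f : ℝ → ℝ) (hf : Continuous f) (hfb : ∃ C, ∀ x, |f x| ≤ C) :
    0 ≤ σ2 ∧
    Tendsto (fun m => (∑ d ∈ A m, f (linStat (b m) d)) / ((A m).card : ℝ)) atTop
      (𝓝 (∫ x, f x ∂(gaussianReal 0 (Real.toNNReal σ2)))) := by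
  set v : ℕ → ℝ := fun m => (∑ i, ∑ g, n m g * b m i g ^ 2) / (N m : ℝ) with hv
  have hv0 : ∀ m, 0 ≤ v m := fun m =>
    div_nonneg (Finset.sum_nonneg fun i _ => Finset.sum_nonneg fun g _ =>
      mul_nonneg ((hA m).nonneg g) (sq_nonneg _)) (by positivity)
  have hσ0 : 0 ≤ σ2 := ge_of_tendsto' hσ hv0
  refine ⟨hσ0, ?_⟩
  have hA0 : ∀ m, (A m).card ≠ 0 := fun m => (hA m).ne.card_pos.ne'
  -- characteristic functions
  have hchar : ∀ t : ℝ, Tendsto (fun m => ((A m).card : ℂ)⁻¹ *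
      ∑ d ∈ A m, Complex.exp (Complex.I * ((t * linStat (b m) d : ℝ) : ℂ))) atTop
      (𝓝 (Complex.exp ((-(σ2 * t ^ 2 / 2) : ℝ) : ℂ))) := by
    intro t
    have h1 : Tendsto (fun m => Complex.exp ((-(v m * t ^ 2 / 2) : ℝ) : ℂ)) atTop
      (𝓝 (Complex.exp ((-(σ2 * t ^ 2 / 2) : ℝ) : ℂ))) := by
      refine (Complex.continuous_exp.tendsto _).comp ?_
      refine (Complex.continuous_ofReal.tendsto _).comp ?_
      exact ((hσ.mul_const _).div_const _).neg
    have h2 : Tendsto (fun m => ((A m).card : ℂ)⁻¹ *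
      ∑ d ∈ A m, Complex.exp (Complex.I * ((t * linStat (b m) d : ℝ) : ℂ))
        - Complex.exp ((-(v m * t ^ 2 / 2) : ℝ) : ℂ)) atTop (𝓝 0) := by
      rw [Metric.tendsto_nhds]
      intro δ hδ
      -- choose ε
      obtain ⟨ε, hε, hεδ⟩ : ∃ ε > 0, (|t| * (ε * (1 / 2 + (σ2 + 1)) + 2 * (σ2 + 1) * 0)
        + 16 * t ^ 2 * ε * (σ2 + 1)) * |t| < δ := by
        have hc : Tendsto (fun ε : ℝ => (|t| * (ε * (1 / 2 + (σ2 + 1)) + 2 * (σ2 + 1) * 0)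
          + 16 * t ^ 2 * ε * (σ2 + 1)) * |t|) (𝓝[>] 0) (𝓝 0) := by
          refine Tendsto.mono_left ?_ nhdsWithin_le_nhds
          have : Continuous (fun ε : ℝ => (|t| * (ε * (1 / 2 + (σ2 + 1)) + 2 * (σ2 + 1) * 0)
            + 16 * t ^ 2 * ε * (σ2 + 1)) * |t|) := by fun_prop
          simpa using this.tendsto 0
        obtain ⟨ε, h1, h2⟩ := ((hc.eventually (gt_mem_nhds hδ)).and self_mem_nhdsWithin).exists
        exact ⟨ε, h2, h1⟩
      have hNinv : Tendsto (fun m => ((N m : ℕ) : ℝ)⁻¹) atTop (𝓝 0) :=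
        tendsto_inv_atTop_zero.comp (tendsto_natCast_atTop_atTop.comp hN)
      have hlim : Tendsto (fun m => (|t| * (ε * (1 / 2 + v m) + 2 * v m * ((N m : ℕ) : ℝ)⁻¹)
        + 16 * t ^ 2 * ε * v m) * |t|) atTop (𝓝 ((|t| * (ε * (1 / 2 + σ2) + 2 * σ2 * 0)
        + 16 * t ^ 2 * ε * σ2) * |t|)) := by
        refine Tendsto.mul_const _ (Tendsto.add (Tendsto.const_mul _ (Tendsto.add
          (Tendsto.const_mul _ (hσ.const_add _)) ((hσ.const_mul _).mul hNinv)))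
          (hσ.const_mul _))
      have hlt : (|t| * (ε * (1 / 2 + σ2) + 2 * σ2 * 0)
        + 16 * t ^ 2 * ε * σ2) * |t| < δ := by
        refine lt_of_le_of_lt ?_ hεδ
        gcongr <;> linarith
      filter_upwards [hsmall ε hε, hlim.eventually (gt_mem_nhds hlt)] with m h3 h4
      rw [dist_zero_right]
      refine lt_of_le_of_lt ((hA m).charBound (by simpa using hN2 m) (b m) (hrow m) (hcol m)
        ε hε h3 (v m) (by simp [hv]) t) ?_
      simpa [div_eq_mul_inv] using h4
    simpa using h2.add h1
  -- measures
  let μ : ℕ → Measure ℝ := fun m =>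
    (((A m).card : ℝ≥0∞)⁻¹) • ∑ d ∈ A m, Measure.dirac (linStat (b m) d)
  have hμp : ∀ m, IsProbabilityMeasure (μ m) := fun m => by
    constructor
    simp only [μ, Measure.smul_apply, Measure.finsetSum_apply, measure_univ, smul_eq_mul,
      Finset.sum_const, nsmul_eq_mul, mul_one]
    exact ENNReal.inv_mul_cancel (by exact_mod_cast hA0 m) (by simp)
  have hint : ∀ {E : Type} [NormedAddCommGroup E] [NormedSpace ℝ E] [CompleteSpace E]
      (F : ℝ → E) (m : ℕ),
      ∫ x, F x ∂(μ m) = ((A m).card : ℝ)⁻¹ • ∑ d ∈ A m, F (linStat (b m) d) := by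
    intro E _ _ _ F m
    simp only [μ]
    rw [integral_smul_measure, integral_finsetSum_measure]
    · simp
    · intro d _
      exact integrable_dirac (by simp)
  let P : ℕ → ProbabilityMeasure ℝ := fun m => ⟨μ m, hμp m⟩
  let P0 : ProbabilityMeasure ℝ := ⟨gaussianReal 0 (Real.toNNReal σ2), inferInstance⟩
  have hconv : Tendsto P atTop (𝓝 P0) := by
    refine ProbabilityMeasure.tendsto_of_tendsto_charFun fun t => ?_
    have e0 : charFun (P0 : Measure ℝ) t = Complex.exp ((-(σ2 * t ^ 2 / 2) : ℝ) : ℂ) := by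
      change charFun (gaussianReal 0 (Real.toNNReal σ2)) t = _
      rw [charFun_gaussianReal]
      simp [Real.coe_toNNReal _ hσ0]
    rw [e0]
    refine (hchar t).congr fun m => ?_
    change _ = charFun (μ m) t
    rw [charFun_apply_real, hint, Complex.real_smul]
    push_cast
    congr 1
    refine Finset.sum_congr rfl fun d _ => ?_
    congr 1
    ring
  obtain ⟨C, hC⟩ := hfb
  let fb : BoundedContinuousFunction ℝ ℝ :=
    BoundedContinuousFunction.ofNormedAddCommGroup f hf C (by simpa using hC)
  have h := (ProbabilityMeasure.tendsto_iff_forall_integral_tendsto.1 hconv) fb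
  refine h.congr fun m => ?_
  change ∫ x, f x ∂(μ m) = _
  rw [hint]
  simp [div_eq_inv_mul]
lemma assigns_count {N : ℕ} {𝒢 : Finset Date} {Ng : Date → ℕ} {d : Fin N → 𝒢}
    (hd : d ∈ assigns N 𝒢 Ng) (h : 𝒢 → ℝ) :
    ∑ i, h (d i) = ∑ g : 𝒢, (Ng g : ℝ) * h g := by
  have hd' := (Finset.mem_filter.1 hd).2
  rw [← Finset.sum_fiberwise_of_maps_to (s := Finset.univ) (t := (Finset.univ : Finset 𝒢))
    (g := d) (fun _ _ => Finset.mem_univ _)]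
  refine Finset.sum_congr rfl fun g _ => ?_
  rw [Finset.sum_congr rfl (g := fun _ => h g)
    (fun i hi => by rw [(Finset.mem_filter.1 hi).2]), Finset.sum_const, nsmul_eq_mul]
  congr 1
  rw [← hd' g g.2]
  norm_cast

lemma assigns_swapInv (N : ℕ) (𝒢 : Finset Date) (Ng : Date → ℕ)
    (hsum : ∑ g ∈ 𝒢, Ng g = N) :
    SwapInv (assigns N 𝒢 Ng) (fun g : 𝒢 => (Ng g : ℝ)) := by
  refine ⟨?_, ?_, ?_, ?_, ?_⟩
  · have hcard : Fintype.card (Fin N) = Fintype.card (Σ g : 𝒢, Fin (Ng g)) := by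
      simp only [Fintype.card_fin, Fintype.card_sigma]
      rw [← hsum, ← Finset.sum_coe_sort]
    let e := Fintype.equivOfCardEq hcard
    refine ⟨fun i => (e i).1, Finset.mem_filter.2 ⟨Finset.mem_univ _, fun g hg => ?_⟩⟩
    have : (Finset.univ.filter fun i => ((e i).1 : Date) = g).card
        = (Finset.univ : Finset (Fin (Ng g))).card := by
      symm
      refine Finset.card_bij (fun k _ => e.symm ⟨⟨g, hg⟩, k⟩) ?_ ?_ ?_
      · intro k _
        simp
      · intro k _ k' _ h
        have := e.symm.injective h
        simpa using this
      · intro i hi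
        have hi' := (Finset.mem_filter.1 hi).2
        obtain ⟨⟨⟨g', hg'⟩, k⟩, rfl⟩ := e.symm.surjective i
        simp only [Equiv.apply_symm_apply] at hi'
        subst hi'
        exact ⟨k, Finset.mem_univ _, rfl⟩
    simpa using this
  · intro d hd i j
    have hd' := (Finset.mem_filter.1 hd).2
    refine Finset.mem_filter.2 ⟨Finset.mem_univ _, fun g hg => ?_⟩
    rw [← hd' g hg]
    refine Finset.card_bij (fun k _ => Equiv.swap i j k) ?_ ?_ ?_
    · intro k hk
      simpa using hk
    · intro k _ k' _ h
      exact (Equiv.swap i j).injective h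
    · intro k hk
      refine ⟨Equiv.swap i j k, ?_, by simp⟩
      simpa using hk
  · intro d hd h
    exact assigns_count hd h
  · intro g; positivity
  · simp only [Fintype.card_fin]
    rw [Finset.sum_coe_sort 𝒢 (fun g => (Ng g : ℝ))]
    exact_mod_cast hsum

lemma weights_eq (T : ℕ) (𝒢 : Finset Date) (a : Fin T → Date → Date → ℝ)
    (z : Date → Fin T → ℝ) :
    ∑ t, ∑ g ∈ 𝒢, ∑ g' ∈ 𝒢, a t g g' * (z g t - z g' t)
      = ∑ g ∈ 𝒢, ∑ t, Atheta T 𝒢 a g t * z g t := by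
  rw [Finset.sum_comm (s := 𝒢)]
  refine Finset.sum_congr rfl fun t _ => ?_
  simp only [Atheta, mul_sub, Finset.sum_sub_distrib, sub_mul, Finset.sum_mul]
  congr 1
  exact Finset.sum_comm

/-- population mean of `Y(g)` in period `t` -/
def mu {N T : ℕ} (Y : Fin N → Date → Fin T → ℝ) (g : Date) (t : Fin T) : ℝ :=
  popMeanS N fun i => Y i g t

/-- combined weights -/
def wt {T M : ℕ} (𝒢 : Finset Date) (a : Fin T → Date → Date → ℝ)
    (b : Fin M → Fin T → Date → Date → ℝ) (c : Fin (M + 1) → ℝ) (g : Date) (t : Fin T) : ℝ :=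
  c 0 * Atheta T 𝒢 a g t + ∑ j : Fin M, c j.succ * A0 T M 𝒢 b g j t

/-- centered unit-level scalars -/
def uu {N T : ℕ} (Y : Fin N → Date → Fin T → ℝ) (w : Date → Fin T → ℝ) (i : Fin N)
    (g : Date) : ℝ := ∑ t, w g t * (Y i g t - mu Y g t)

/-- doubly centered array -/
def bb {N T : ℕ} (𝒢 : Finset Date) (Ng : Date → ℕ) (Y : Fin N → Date → Fin T → ℝ)
    (w : Date → Fin T → ℝ) (i : Fin N) (g : 𝒢) : ℝ :=
  Real.sqrt (N : ℝ) * (uu Y w i g / (Ng g : ℝ) - (∑ h ∈ 𝒢, uu Y w i h) / (N : ℝ))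

lemma sum_center {N T : ℕ} (hN : 2 ≤ N) (Y : Fin N → Date → Fin T → ℝ) (g : Date) (t : Fin T) :
    ∑ i, (Y i g t - mu Y g t) = 0 := by
  have : (N : ℝ) ≠ 0 := by positivity
  simp only [mu, popMeanS, Finset.sum_sub_distrib, Finset.sum_const, Finset.card_univ,
    Fintype.card_fin, nsmul_eq_mul]
  field_simp
  ring

lemma sum_uu {N T : ℕ} (hN : 2 ≤ N) (Y : Fin N → Date → Fin T → ℝ) (w : Date → Fin T → ℝ)
    (g : Date) : ∑ i, uu Y w i g = 0 := by
  unfold uu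
  rw [Finset.sum_comm]
  simp [← Finset.mul_sum, sum_center hN]

lemma bb_row {N T : ℕ} (hN : 2 ≤ N) (𝒢 : Finset Date) (Ng : Date → ℕ)
    (hNg : ∀ g ∈ 𝒢, 1 ≤ Ng g) (hsum : ∑ g ∈ 𝒢, Ng g = N)
    (Y : Fin N → Date → Fin T → ℝ) (w : Date → Fin T → ℝ) (i : Fin N) :
    ∑ g : 𝒢, (Ng g : ℝ) * bb 𝒢 Ng Y w i g = 0 := by
  have h0 : (N : ℝ) ≠ 0 := by positivity
  have hs : ∑ g ∈ 𝒢, (Ng g : ℝ) = (N : ℝ) := by exact_mod_cast hsum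
  unfold bb
  rw [Finset.sum_coe_sort 𝒢 (fun g => (Ng g : ℝ) *
    (Real.sqrt (N : ℝ) * (uu Y w i g / (Ng g : ℝ) - (∑ h ∈ 𝒢, uu Y w i h) / (N : ℝ))))]
  have : ∀ g ∈ 𝒢, (Ng g : ℝ) *
    (Real.sqrt (N : ℝ) * (uu Y w i g / (Ng g : ℝ) - (∑ h ∈ 𝒢, uu Y w i h) / (N : ℝ)))
    = Real.sqrt N * (uu Y w i g) - (Ng g : ℝ) * (Real.sqrt N * ((∑ h ∈ 𝒢, uu Y w i h) / N)) := by
    intro g hg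
    have : (Ng g : ℝ) ≠ 0 := by have := hNg g hg; positivity
    field_simp
  rw [Finset.sum_congr rfl this, Finset.sum_sub_distrib, ← Finset.mul_sum, ← Finset.sum_mul, hs]
  field_simp
  ring

lemma bb_col {N T : ℕ} (hN : 2 ≤ N) (𝒢 : Finset Date) (Ng : Date → ℕ)
    (Y : Fin N → Date → Fin T → ℝ) (w : Date → Fin T → ℝ) (g : 𝒢) :
    ∑ i, bb 𝒢 Ng Y w i g = 0 := by
  unfold bb
  rw [← Finset.mul_sum, Finset.sum_sub_distrib, ← Finset.sum_div, ← Finset.sum_div,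
    sum_uu hN, Finset.sum_comm]
  simp [sum_uu hN]

lemma A0_zero {N T M : ℕ} (𝒢 : Finset Date) (Y : Fin N → Date → Fin T → ℝ)
    (b : Fin M → Fin T → Date → Date → ℝ)
    (hNA : ∀ (i : Fin N) (t : Fin T), ∀ g ∈ 𝒢, ∀ g' ∈ 𝒢,
      periodLT t g → periodLT t g' → Y i g t = Y i g' t)
    (hb : ∀ (j : Fin M) (t : Fin T) (g g' : Date),
      b j t g g' ≠ 0 → periodLT t g ∧ periodLT t g') (i : Fin N) (j : Fin M) :
    ∑ g ∈ 𝒢, ∑ t, A0 T M 𝒢 b g j t * (Y i g t - mu Y g t) = 0 := by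
  have h := weights_eq T 𝒢 (b j) (fun g t => Y i g t - mu Y g t)
  refine Eq.trans h.symm ?_
  refine Finset.sum_eq_zero fun t _ => Finset.sum_eq_zero fun g hg =>
    Finset.sum_eq_zero fun g' hg' => ?_
  by_cases h0 : b j t g g' = 0
  · simp [h0]
  · obtain ⟨h1, h2⟩ := hb j t g g' h0
    have e : ∀ i, Y i g t = Y i g' t := fun i => hNA i t g hg g' hg' h1 h2
    simp [mu, e]

lemma A0_mu_zero {N T M : ℕ} (𝒢 : Finset Date) (Y : Fin N → Date → Fin T → ℝ)
    (b : Fin M → Fin T → Date → Date → ℝ)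
    (hNA : ∀ (i : Fin N) (t : Fin T), ∀ g ∈ 𝒢, ∀ g' ∈ 𝒢,
      periodLT t g → periodLT t g' → Y i g t = Y i g' t)
    (hb : ∀ (j : Fin M) (t : Fin T) (g g' : Date),
      b j t g g' ≠ 0 → periodLT t g ∧ periodLT t g') (j : Fin M) :
    ∑ g ∈ 𝒢, ∑ t, A0 T M 𝒢 b g j t * mu Y g t = 0 := by
  have h := weights_eq T 𝒢 (b j) (fun g t => mu Y g t)
  refine Eq.trans h.symm ?_
  refine Finset.sum_eq_zero fun t _ => Finset.sum_eq_zero fun g hg =>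
    Finset.sum_eq_zero fun g' hg' => ?_
  by_cases h0 : b j t g g' = 0
  · simp [h0]
  · obtain ⟨h1, h2⟩ := hb j t g g' h0
    have e : ∀ i, Y i g t = Y i g' t := fun i => hNA i t g hg g' hg' h1 h2
    simp [mu, e]

lemma sum_wt {T M : ℕ} (𝒢 : Finset Date) (a : Fin T → Date → Date → ℝ)
    (b : Fin M → Fin T → Date → Date → ℝ) (c : Fin (M + 1) → ℝ) (z : Date → Fin T → ℝ) :
    ∑ g ∈ 𝒢, ∑ t, wt 𝒢 a b c g t * z g t
      = c 0 * ∑ g ∈ 𝒢, ∑ t, Atheta T 𝒢 a g t * z g t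
        + ∑ j : Fin M, c j.succ * ∑ g ∈ 𝒢, ∑ t, A0 T M 𝒢 b g j t * z g t := by
  simp only [wt, add_mul, Finset.sum_add_distrib, Finset.sum_mul, Finset.mul_sum]
  congr 1
  · refine Finset.sum_congr rfl fun g _ => Finset.sum_congr rfl fun t _ => by ring
  · rw [Finset.sum_comm (s := (Finset.univ : Finset (Fin M)))]
    refine Finset.sum_congr rfl fun g _ => ?_
    rw [Finset.sum_comm]
    refine Finset.sum_congr rfl fun j _ => Finset.sum_congr rfl fun t _ => by ring

lemma stat_eq {N T M : ℕ} (hN : 2 ≤ N) (𝒢 : Finset Date) (Ng : Date → ℕ)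
    (hNg : ∀ g ∈ 𝒢, 1 ≤ Ng g)
    (Y : Fin N → Date → Fin T → ℝ)
    (a : Fin T → Date → Date → ℝ) (b : Fin M → Fin T → Date → Date → ℝ)
    (hNA : ∀ (i : Fin N) (t : Fin T), ∀ g ∈ 𝒢, ∀ g' ∈ 𝒢,
      periodLT t g → periodLT t g' → Y i g t = Y i g' t)
    (hb : ∀ (j : Fin M) (t : Fin T) (g g' : Date),
      b j t g g' ≠ 0 → periodLT t g ∧ periodLT t g')
    (c : Fin (M + 1) → ℝ) (d : Fin N → 𝒢) (hd : d ∈ assigns N 𝒢 Ng) :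
    Real.sqrt (N : ℝ) * (c ⬝ᵥ Fin.cons
        (thetaHat0 𝒢 Ng a (obs Y d) d - thetaParam N T 𝒢 Y a)
        (Xhat 𝒢 Ng b (obs Y d) d))
      = linStat (bb 𝒢 Ng Y (wt 𝒢 a b c)) d := by
  have hd' := (Finset.mem_filter.1 hd).2
  have h0 : (N : ℝ) ≠ 0 := by positivity
  have e1 : thetaHat0 𝒢 Ng a (obs Y d) d
      = ∑ g ∈ 𝒢, ∑ t, Atheta T 𝒢 a g t * cmean Ng (obs Y d) d g t :=
    weights_eq T 𝒢 a (fun g t => cmean Ng (obs Y d) d g t)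
  have e2 : thetaParam N T 𝒢 Y a = ∑ g ∈ 𝒢, ∑ t, Atheta T 𝒢 a g t * mu Y g t := by
    rw [← weights_eq T 𝒢 a (fun g t => mu Y g t)]
    simp only [thetaParam, tau, mu, popMeanS, Finset.sum_sub_distrib, sub_div]
  have e3 : ∀ j, Xhat 𝒢 Ng b (obs Y d) d j
      = ∑ g ∈ 𝒢, ∑ t, A0 T M 𝒢 b g j t * cmean Ng (obs Y d) d g t := fun j =>
    weights_eq T 𝒢 (b j) (fun g t => cmean Ng (obs Y d) d g t)
  have e4 : c ⬝ᵥ Fin.cons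
        (thetaHat0 𝒢 Ng a (obs Y d) d - thetaParam N T 𝒢 Y a)
        (Xhat 𝒢 Ng b (obs Y d) d)
      = ∑ g ∈ 𝒢, ∑ t, wt 𝒢 a b c g t * (cmean Ng (obs Y d) d g t - mu Y g t) := by
    rw [sum_wt]
    simp only [dotProduct, Fin.sum_univ_succ, Fin.cons_zero, Fin.cons_succ, e1, e2, e3,
      mul_sub, Finset.sum_sub_distrib, A0_mu_zero 𝒢 Y b hNA hb, sub_zero]
  have e5 : ∀ g ∈ 𝒢, ∀ t, cmean Ng (obs Y d) d g t - mu Y g t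
      = ∑ i, if (d i : Date) = g then (Y i g t - mu Y g t) / (Ng g : ℝ) else 0 := by
    intro g hg t
    have hg0 : (Ng g : ℝ) ≠ 0 := by have := hNg g hg; positivity
    have : ∑ i, (if (d i : Date) = g then mu Y g t / (Ng g : ℝ) else 0) = mu Y g t := by
      rw [← Finset.sum_filter, Finset.sum_const, hd' g hg, nsmul_eq_mul]
      field_simp
    conv_lhs => rw [← this]
    simp only [cmean, obs]
    rw [Finset.sum_div, ← Finset.sum_sub_distrib]
    refine Finset.sum_congr rfl fun i _ => ?_
    split_ifs with h
    · rw [← h]; ring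
    · simp
  have e6 : ∑ g ∈ 𝒢, ∑ t, wt 𝒢 a b c g t * (cmean Ng (obs Y d) d g t - mu Y g t)
      = ∑ i, uu Y (wt 𝒢 a b c) i (d i) / (Ng (d i) : ℝ) := by
    calc _ = ∑ g ∈ 𝒢, ∑ i, if (d i : Date) = g then
          uu Y (wt 𝒢 a b c) i g / (Ng g : ℝ) else 0 := by
          refine Finset.sum_congr rfl fun g hg => ?_
          rw [Finset.sum_congr rfl fun t _ => by rw [e5 g hg t, Finset.mul_sum], Finset.sum_comm]
          refine Finset.sum_congr rfl fun i _ => ?_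
          split_ifs with h
          · rw [uu, Finset.sum_div]
            exact Finset.sum_congr rfl fun t _ => by ring
          · simp
      _ = _ := by
          rw [Finset.sum_comm]
          refine Finset.sum_congr rfl fun i _ => ?_
          rw [Finset.sum_ite_eq]
          simp
  rw [e4, e6]
  unfold linStat bb
  have e7 : ∑ i, (∑ h ∈ 𝒢, uu Y (wt 𝒢 a b c) i h) / (N : ℝ) = 0 := by
    rw [← Finset.sum_div, Finset.sum_comm]
    simp [sum_uu hN]
  rw [← Finset.mul_sum, Finset.sum_sub_distrib, e7, sub_zero]

lemma quad_sum {ι α : Type*} [Fintype ι] (P : Finset α) (x : α → ℝ) (y : ι → α → ℝ) :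
    ∑ i, (∑ p ∈ P, x p * y i p) ^ 2
      = ∑ p ∈ P, ∑ q ∈ P, x p * x q * ∑ i, y i p * y i q := by
  simp_rw [sq, Finset.sum_mul_sum]
  rw [Finset.sum_comm]
  refine Finset.sum_congr rfl fun p _ => ?_
  rw [Finset.sum_comm]
  refine Finset.sum_congr rfl fun q _ => ?_
  rw [Finset.mul_sum]
  exact Finset.sum_congr rfl fun i _ => by ring

lemma uu_sq_sum {N T : ℕ} (hN : 2 ≤ N) (Y : Fin N → Date → Fin T → ℝ) (w : Date → Fin T → ℝ)
    (g : Date) :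
    ∑ i, uu Y w i g ^ 2 = ((N : ℝ) - 1) * (w g ⬝ᵥ (Sg N T Y g).mulVec (w g)) := by
  have hN1 : (N : ℝ) - 1 ≠ 0 := by
    have : (2 : ℝ) ≤ N := by exact_mod_cast hN
    linarith
  unfold uu
  rw [quad_sum]
  simp only [dotProduct, mulVec, Finset.mul_sum]
  refine Finset.sum_congr rfl fun p _ => Finset.sum_congr rfl fun q _ => ?_
  have : Sg N T Y g p q = (∑ i, (Y i g p - mu Y g p) * (Y i g q - mu Y g q)) / ((N : ℝ) - 1) :=
    rfl
  rw [this, ← Finset.mul_sum]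
  field_simp

lemma Stheta_center {N T : ℕ} (𝒢 : Finset Date) (Y : Fin N → Date → Fin T → ℝ)
    (a : Fin T → Date → Date → ℝ) :
    Stheta N T 𝒢 Y a = (∑ i, (∑ g ∈ 𝒢, ∑ t, Atheta T 𝒢 a g t * (Y i g t - mu Y g t)) ^ 2)
      / ((N : ℝ) - 1) := by
  unfold Stheta popVarS
  congr 1
  refine Finset.sum_congr rfl fun i _ => ?_
  congr 1
  simp only [mul_sub, Finset.sum_sub_distrib, dotProduct]
  congr 1
  simp only [popMeanS, mu, ← mul_div_assoc, Finset.mul_sum, Finset.sum_div]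
  rw [Finset.sum_comm]
  refine Finset.sum_congr rfl fun g _ => ?_
  rw [Finset.sum_comm]

lemma Stheta_quad {N T : ℕ} (𝒢 : Finset Date) (Y : Fin N → Date → Fin T → ℝ)
    (a : Fin T → Date → Date → ℝ) :
    Stheta N T 𝒢 Y a = ∑ p ∈ 𝒢 ×ˢ (Finset.univ : Finset (Fin T)),
      ∑ q ∈ 𝒢 ×ˢ (Finset.univ : Finset (Fin T)),
        Atheta T 𝒢 a p.1 p.2 * Atheta T 𝒢 a q.1 q.2 * Sgg N T Y p.1 q.1 p.2 q.2 := by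
  rw [Stheta_center]
  have : ∀ i, ∑ g ∈ 𝒢, ∑ t, Atheta T 𝒢 a g t * (Y i g t - mu Y g t)
      = ∑ p ∈ 𝒢 ×ˢ (Finset.univ : Finset (Fin T)),
        Atheta T 𝒢 a p.1 p.2 * (Y i p.1 p.2 - mu Y p.1 p.2) := fun i => by
    rw [Finset.sum_product]
  simp_rw [this]
  have hq := quad_sum (𝒢 ×ˢ (Finset.univ : Finset (Fin T)))
    (fun p => Atheta T 𝒢 a p.1 p.2) (fun (i : Fin N) p => Y i p.1 p.2 - mu Y p.1 p.2)
  refine (congrArg (fun x => x / ((N : ℝ) - 1)) hq).trans ?_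
  beta_reduce
  rw [Finset.sum_div]
  refine Finset.sum_congr rfl fun p _ => ?_
  rw [Finset.sum_div]
  refine Finset.sum_congr rfl fun q _ => ?_
  rw [mul_div_assoc]
  rfl

lemma bb_var {N T M : ℕ} (hN : 2 ≤ N) (𝒢 : Finset Date) (Ng : Date → ℕ)
    (hNg : ∀ g ∈ 𝒢, 1 ≤ Ng g) (hsum : ∑ g ∈ 𝒢, Ng g = N)
    (Y : Fin N → Date → Fin T → ℝ)
    (a : Fin T → Date → Date → ℝ) (b : Fin M → Fin T → Date → Date → ℝ)
    (hNA : ∀ (i : Fin N) (t : Fin T), ∀ g ∈ 𝒢, ∀ g' ∈ 𝒢,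
      periodLT t g → periodLT t g' → Y i g t = Y i g' t)
    (hb : ∀ (j : Fin M) (t : Fin T) (g g' : Date),
      b j t g g' ≠ 0 → periodLT t g ∧ periodLT t g')
    (c : Fin (M + 1) → ℝ) :
    (∑ i, ∑ g : 𝒢, (Ng g : ℝ) * bb 𝒢 Ng Y (wt 𝒢 a b c) i g ^ 2) / (N : ℝ)
      = (1 - (N : ℝ)⁻¹) * (∑ g ∈ 𝒢, ((Ng g : ℝ) / N)⁻¹ *
          (wt 𝒢 a b c g ⬝ᵥ (Sg N T Y g).mulVec (wt 𝒢 a b c g))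
          - c 0 ^ 2 * Stheta N T 𝒢 Y a) := by
  have h0 : (N : ℝ) ≠ 0 := by positivity
  have hN1 : (N : ℝ) - 1 ≠ 0 := by
    have : (2 : ℝ) ≤ N := by exact_mod_cast hN
    linarith
  have hs : ∑ g ∈ 𝒢, (Ng g : ℝ) = (N : ℝ) := by exact_mod_cast hsum
  set w := wt 𝒢 a b c with hw
  have hi : ∀ i, ∑ g : 𝒢, (Ng g : ℝ) * bb 𝒢 Ng Y w i g ^ 2
      = N * (∑ g ∈ 𝒢, (Ng g : ℝ)⁻¹ * uu Y w i g ^ 2 - (∑ h ∈ 𝒢, uu Y w i h) ^ 2 / N) := by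
    intro i
    unfold bb
    rw [Finset.sum_coe_sort 𝒢 (fun g => (Ng g : ℝ) *
      (Real.sqrt (N : ℝ) * (uu Y w i g / (Ng g : ℝ) - (∑ h ∈ 𝒢, uu Y w i h) / (N : ℝ))) ^ 2)]
    set U := ∑ h ∈ 𝒢, uu Y w i h with hU
    have : ∀ g ∈ 𝒢, (Ng g : ℝ) *
      (Real.sqrt (N : ℝ) * (uu Y w i g / (Ng g : ℝ) - U / (N : ℝ))) ^ 2
      = N * ((Ng g : ℝ)⁻¹ * uu Y w i g ^ 2) - 2 * U * uu Y w i g + (Ng g : ℝ) * (U ^ 2 / N) := by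
      intro g hg
      have : (Ng g : ℝ) ≠ 0 := by have := hNg g hg; positivity
      rw [mul_pow, Real.sq_sqrt (by positivity)]
      field_simp
      ring
    rw [Finset.sum_congr rfl this, Finset.sum_add_distrib, Finset.sum_sub_distrib,
      ← Finset.mul_sum, ← Finset.mul_sum, ← Finset.sum_mul, hs, ← hU]
    field_simp
    ring
  have hU : ∀ i, ∑ h ∈ 𝒢, uu Y w i h
      = c 0 * ∑ g ∈ 𝒢, ∑ t, Atheta T 𝒢 a g t * (Y i g t - mu Y g t) := by
    intro i
    unfold uu
    rw [hw, sum_wt]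
    simp [A0_zero 𝒢 Y b hNA hb]
  have hS : ∑ i, (∑ h ∈ 𝒢, uu Y w i h) ^ 2 = c 0 ^ 2 * (((N : ℝ) - 1) * Stheta N T 𝒢 Y a) := by
    simp_rw [hU, mul_pow]
    rw [← Finset.mul_sum, Stheta_center]
    field_simp
  simp_rw [hi]
  rw [← Finset.mul_sum, Finset.sum_sub_distrib, ← Finset.sum_div, hS, Finset.sum_comm]
  simp_rw [← Finset.mul_sum, uu_sq_sum hN]
  rw [mul_div_cancel_left₀ _ h0, mul_sub, Finset.mul_sum]
  congr 1
  · refine Finset.sum_congr rfl fun g _ => ?_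
    rw [inv_div]
    field_simp
  · field_simp

lemma limit_var {T M : ℕ} (𝒢 : Finset Date)
    (a : Fin T → Date → Date → ℝ) (b : Fin M → Fin T → Date → Date → ℝ)
    (p : Date → ℝ) (Sstar : Date → Matrix (Fin T) (Fin T) ℝ)
    (hsym : ∀ g ∈ 𝒢, (Sstar g)ᵀ = Sstar g) (Sth : ℝ) (c : Fin (M + 1) → ℝ) :
    ∑ g ∈ 𝒢, (p g)⁻¹ * (wt 𝒢 a b c g ⬝ᵥ (Sstar g).mulVec (wt 𝒢 a b c g)) - c 0 ^ 2 * Sth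
    = c ⬝ᵥ (Matrix.of
              ((Fin.cons
                (Fin.cons (VstarTheta T 𝒢 a p Sstar Sth)
                  (VstarXtheta T M 𝒢 a b p Sstar))
                (fun j => Fin.cons (VstarXtheta T M 𝒢 a b p Sstar j)
                  (fun k => VstarX T M 𝒢 b p Sstar j k)))
                : Fin (M + 1) → Fin (M + 1) → ℝ)).mulVec c := by
  set c' : Fin M → ℝ := fun j => c j.succ with hc'
  have hR : c ⬝ᵥ (Matrix.of
              ((Fin.cons
                (Fin.cons (VstarTheta T 𝒢 a p Sstar Sth)
                  (VstarXtheta T M 𝒢 a b p Sstar))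
                (fun j => Fin.cons (VstarXtheta T M 𝒢 a b p Sstar j)
                  (fun k => VstarX T M 𝒢 b p Sstar j k)))
                : Fin (M + 1) → Fin (M + 1) → ℝ)).mulVec c
      = c 0 ^ 2 * VstarTheta T 𝒢 a p Sstar Sth
        + 2 * c 0 * (c' ⬝ᵥ VstarXtheta T M 𝒢 a b p Sstar)
        + c' ⬝ᵥ (VstarX T M 𝒢 b p Sstar).mulVec c' := by
    simp only [dotProduct, mulVec, Fin.sum_univ_succ, Matrix.of_apply, Fin.cons_zero,
      Fin.cons_succ, hc', mul_add, Finset.sum_add_distrib]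
    have h1 : ∑ x : Fin M, c x.succ * (VstarXtheta T M 𝒢 a b p Sstar x * c 0)
      = c 0 * ∑ x : Fin M, c x.succ * VstarXtheta T M 𝒢 a b p Sstar x := by
      rw [Finset.mul_sum]; exact Finset.sum_congr rfl fun _ _ => by ring
    have h2 : ∑ x : Fin M, VstarXtheta T M 𝒢 a b p Sstar x * c x.succ
      = ∑ x : Fin M, c x.succ * VstarXtheta T M 𝒢 a b p Sstar x :=
      Finset.sum_congr rfl fun _ _ => by ring
    rw [h1, h2]
    ring
  have hwt : ∀ g, wt 𝒢 a b c g = c 0 • Atheta T 𝒢 a g + (A0 T M 𝒢 b g)ᵀ.mulVec c' := by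
    intro g
    ext t
    simp only [wt, Pi.add_apply, Pi.smul_apply, smul_eq_mul, mulVec, dotProduct,
      Matrix.transpose_apply, hc']
    congr 1
    exact Finset.sum_congr rfl fun _ _ => by ring
  have hX : c' ⬝ᵥ VstarXtheta T M 𝒢 a b p Sstar = ∑ g ∈ 𝒢, (p g)⁻¹ *
      ((A0 T M 𝒢 b g)ᵀ.mulVec c' ⬝ᵥ (Sstar g).mulVec (Atheta T 𝒢 a g)) := by
    unfold VstarXtheta
    rw [dotProduct_sum]
    refine Finset.sum_congr rfl fun g _ => ?_
    rw [dotProduct_smul, smul_eq_mul, ← Matrix.mulVec_mulVec, Matrix.dotProduct_mulVec,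
      ← Matrix.mulVec_transpose]
  have hXX : c' ⬝ᵥ (VstarX T M 𝒢 b p Sstar).mulVec c' = ∑ g ∈ 𝒢, (p g)⁻¹ *
      ((A0 T M 𝒢 b g)ᵀ.mulVec c' ⬝ᵥ (Sstar g).mulVec ((A0 T M 𝒢 b g)ᵀ.mulVec c')) := by
    unfold VstarX
    rw [Matrix.sum_mulVec, dotProduct_sum]
    refine Finset.sum_congr rfl fun g _ => ?_
    rw [Matrix.smul_mulVec, dotProduct_smul, smul_eq_mul, ← Matrix.mulVec_mulVec,
      ← Matrix.mulVec_mulVec, Matrix.dotProduct_mulVec, ← Matrix.mulVec_transpose]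
  rw [hR, hX, hXX]
  unfold VstarTheta
  rw [mul_sub, Finset.mul_sum, Finset.mul_sum]
  have : ∀ g ∈ 𝒢, (p g)⁻¹ * (wt 𝒢 a b c g ⬝ᵥ (Sstar g).mulVec (wt 𝒢 a b c g))
      = c 0 ^ 2 * ((p g)⁻¹ * (Atheta T 𝒢 a g ⬝ᵥ (Sstar g).mulVec (Atheta T 𝒢 a g)))
      + 2 * c 0 * ((p g)⁻¹ *
      ((A0 T M 𝒢 b g)ᵀ.mulVec c' ⬝ᵥ (Sstar g).mulVec (Atheta T 𝒢 a g)))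
      + (p g)⁻¹ *
      ((A0 T M 𝒢 b g)ᵀ.mulVec c' ⬝ᵥ (Sstar g).mulVec ((A0 T M 𝒢 b g)ᵀ.mulVec c')) := by
    intro g hg
    rw [hwt]
    have hs : Atheta T 𝒢 a g ⬝ᵥ (Sstar g).mulVec ((A0 T M 𝒢 b g)ᵀ.mulVec c')
        = (A0 T M 𝒢 b g)ᵀ.mulVec c' ⬝ᵥ (Sstar g).mulVec (Atheta T 𝒢 a g) := by
      rw [Matrix.dotProduct_mulVec, ← Matrix.mulVec_transpose, hsym g hg, dotProduct_comm]
    simp only [Matrix.mulVec_add, Matrix.mulVec_smul, dotProduct_add, add_dotProduct,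
      smul_dotProduct, dotProduct_smul, smul_eq_mul]
    rw [hs]
    ring
  rw [Finset.sum_congr rfl this, Finset.sum_add_distrib, Finset.sum_add_distrib]
  ring

lemma bb_small {T : ℕ} (𝒢 : Finset Date) (N : ℕ → ℕ) (Ng : ℕ → Date → ℕ)
    (Y : ∀ m, Fin (N m) → Date → Fin T → ℝ) (w : Date → Fin T → ℝ)
    (p : Date → ℝ) (hN2 : ∀ m, 2 ≤ N m)
    (hp : ∀ g ∈ 𝒢, 0 < p g ∧ p g < 1)
    (hpconv : ∀ g ∈ 𝒢, Tendsto (fun m => (Ng m g : ℝ) / (N m : ℝ)) atTop (𝓝 (p g)))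
    (hLind : ∀ ε > (0 : ℝ), ∀ᶠ m in atTop, ∀ (i : Fin (N m)), ∀ g ∈ 𝒢,
      (∑ t, (Y m i g t - popMeanS (N m) fun i' => Y m i' g t) ^ 2) / (N m : ℝ) < ε)
    (ε : ℝ) (hε : 0 < ε) :
    ∀ᶠ m in atTop, ∀ i g, |bb 𝒢 (Ng m) (Y m) w i g| ≤ ε := by
  set K : ℝ := 1 + ∑ g ∈ 𝒢, ∑ t, w g t ^ 2 with hK
  have hK0 : 0 < K := by positivity
  set R : ℝ := 1 + ∑ g ∈ 𝒢, (p g)⁻¹ with hR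
  have hR0 : 0 < R := by
    have : 0 ≤ ∑ g ∈ 𝒢, (p g)⁻¹ := Finset.sum_nonneg fun g hg => (inv_pos.2 (hp g hg).1).le
    linarith
  set η : ℝ := ε / (R + 𝒢.card) with hη
  have hη0 : 0 < η := by positivity
  have hratio : ∀ᶠ m in atTop, ∀ g ∈ 𝒢, ((Ng m g : ℝ) / (N m : ℝ))⁻¹ ≤ R := by
    rw [Filter.eventually_all_finset]
    intro g hg
    have h1 := (hpconv g hg).inv₀ (hp g hg).1.ne'
    have h2 : (p g)⁻¹ < R := by
      have := Finset.single_le_sum (f := fun g => (p g)⁻¹)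
        (fun g hg => (inv_pos.2 (hp g hg).1).le) hg
      linarith
    filter_upwards [h1.eventually (gt_mem_nhds h2)] with m hm using hm.le
  filter_upwards [hLind (η ^ 2 / K) (by positivity), hratio] with m h1 h2 i g
  have hNpos : (0 : ℝ) < N m := by have := hN2 m; positivity
  have hu : ∀ g ∈ 𝒢, |uu (Y m) w i g| ≤ η * Real.sqrt (N m) := by
    intro g hg
    have hcs := Finset.sum_mul_sq_le_sq_mul_sq Finset.univ (w g)
      (fun t => Y m i g t - mu (Y m) g t)
    have h3 := h1 i g hg
    change (∑ t, (Y m i g t - mu (Y m) g t) ^ 2) / (N m : ℝ) < _ at h3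
    rw [div_lt_iff₀ hNpos] at h3
    have h4 : ∑ t, w g t ^ 2 ≤ K := by
      have := Finset.single_le_sum (f := fun g => ∑ t, w g t ^ 2)
        (fun g _ => Finset.sum_nonneg fun t _ => sq_nonneg (w g t)) hg
      linarith
    refine abs_le_of_sq_le_sq ?_ (by positivity)
    rw [mul_pow, Real.sq_sqrt hNpos.le]
    refine hcs.trans ?_
    calc (∑ t, w g t ^ 2) * ∑ t, (Y m i g t - mu (Y m) g t) ^ 2
        ≤ K * (η ^ 2 / K * N m) :=
          mul_le_mul h4 h3.le (Finset.sum_nonneg fun t _ => sq_nonneg _) hK0.le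
      _ = η ^ 2 * N m := by field_simp
  have hs : Real.sqrt (N m) * Real.sqrt (N m) = N m := Real.mul_self_sqrt hNpos.le
  have hs0 : 0 ≤ Real.sqrt (N m) := Real.sqrt_nonneg _
  have hsum : |∑ h ∈ 𝒢, uu (Y m) w i h| ≤ 𝒢.card * (η * Real.sqrt (N m)) := by
    refine (Finset.abs_sum_le_sum_abs _ _).trans ?_
    refine (Finset.sum_le_sum hu).trans ?_
    simp
  unfold bb
  rw [abs_mul, abs_of_nonneg hs0]
  calc Real.sqrt (N m) * |uu (Y m) w i g / (Ng m g : ℝ) - (∑ h ∈ 𝒢, uu (Y m) w i h) / (N m : ℝ)|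
      ≤ Real.sqrt (N m) * (η * Real.sqrt (N m) / (Ng m g : ℝ)
          + 𝒢.card * (η * Real.sqrt (N m)) / (N m : ℝ)) := by
        refine mul_le_mul_of_nonneg_left ?_ hs0
        refine (abs_sub _ _).trans ?_
        rw [abs_div, abs_div, Nat.abs_cast, Nat.abs_cast]
        gcongr
        exact hu g g.2
    _ = η * (((Ng m g : ℝ) / (N m : ℝ))⁻¹ * ((N m : ℝ) / (N m : ℝ))
          + 𝒢.card * ((N m : ℝ) / (N m : ℝ))) := by
        have e : Real.sqrt (N m) * (η * Real.sqrt (N m) / (Ng m g : ℝ)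
            + 𝒢.card * (η * Real.sqrt (N m)) / (N m : ℝ))
            = η * ((Real.sqrt (N m) * Real.sqrt (N m)) / (Ng m g : ℝ)
              + 𝒢.card * ((Real.sqrt (N m) * Real.sqrt (N m)) / (N m : ℝ))) := by ring
        rw [e, hs, inv_div, div_self hNpos.ne', mul_one, mul_one]
    _ ≤ η * (R + 𝒢.card) := by
        rw [div_self hNpos.ne', mul_one, mul_one]
        gcongr
        exact h2 g g.2
    _ = ε := by rw [hη]; field_simp

end Staggered

namespace Staggered

/-- **Lemma A1, joint asymptotic normality.** Under Assumptions 1, 2 and 3,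
`√N (θ̂₀ - θ, X̂)` converges in distribution to `N(0, V*)`; stated via the Cramér–Wold
device: for every `c ∈ ℝ^{M+1}` and every bounded continuous test function `f`,
`E[f(√N c'(θ̂₀ - θ, X̂))] → ∫ f dN(0, c'V*c)`. The limit `S*_θ` of `S_θ` exists. -/
theorem statement9
    (T M : ℕ) (𝒢 : Finset Date) (N : ℕ → ℕ) (Ng : ℕ → Date → ℕ)
    (Y : ∀ m, Fin (N m) → Date → Fin T → ℝ)
    (a : Fin T → Date → Date → ℝ) (b : Fin M → Fin T → Date → Date → ℝ)
    (p : Date → ℝ) (Sstar : Date → Matrix (Fin T) (Fin T) ℝ)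
    (SstarCross : Date → Date → Matrix (Fin T) (Fin T) ℝ)
    (hN2 : ∀ m, 2 ≤ N m) (hNtop : Tendsto N atTop atTop)
    (h𝒢ne : 𝒢.Nonempty) (h𝒢 : ∀ g ∈ 𝒢, (1 ≤ g ∧ g ≤ (T : Date)) ∨ g = ⊤)
    (hNg : ∀ m, ∀ g ∈ 𝒢, 1 ≤ Ng m g) (hsum : ∀ m, ∑ g ∈ 𝒢, Ng m g = N m)
    (hNA : ∀ m (i : Fin (N m)) (t : Fin T), ∀ g ∈ 𝒢, ∀ g' ∈ 𝒢,
      periodLT t g → periodLT t g' → Y m i g t = Y m i g' t)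
    (hb : ∀ (j : Fin M) (t : Fin T) (g g' : Date),
      b j t g g' ≠ 0 → periodLT t g ∧ periodLT t g')
    (hp : ∀ g ∈ 𝒢, 0 < p g ∧ p g < 1)
    (hpconv : ∀ g ∈ 𝒢, Tendsto (fun m => (Ng m g : ℝ) / (N m : ℝ)) atTop (𝓝 (p g)))
    (hSconv : ∀ g ∈ 𝒢, ∀ t t' : Fin T,
      Tendsto (fun m => Sg (N m) T (Y m) g t t') atTop (𝓝 (Sstar g t t')))
    (hScross : ∀ g ∈ 𝒢, ∀ g' ∈ 𝒢, ∀ t t' : Fin T,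
      Tendsto (fun m => Sgg (N m) T (Y m) g g' t t') atTop (𝓝 (SstarCross g g' t t')))
    (hSpd : ∀ g ∈ 𝒢, (Sstar g).PosDef)
    (hLind : ∀ ε > (0 : ℝ), ∀ᶠ m in atTop, ∀ (i : Fin (N m)), ∀ g ∈ 𝒢,
      (∑ t, (Y m i g t - popMeanS (N m) fun i' => Y m i' g t) ^ 2) / (N m : ℝ) < ε) :
    ∃ Sthetastar : ℝ,
      Tendsto (fun m => Stheta (N m) T 𝒢 (Y m) a) atTop (𝓝 Sthetastar) ∧
      ∀ c : Fin (M + 1) → ℝ, ∀ f : ℝ → ℝ, Continuous f → IsBounded f →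
        Tendsto (fun m => expec (N m) 𝒢 (Ng m) fun d =>
            f (Real.sqrt (N m : ℝ) *
              (c ⬝ᵥ Fin.cons
                (thetaHat0 𝒢 (Ng m) a (obs (Y m) d) d - thetaParam (N m) T 𝒢 (Y m) a)
                (Xhat 𝒢 (Ng m) b (obs (Y m) d) d))))
          atTop
          (𝓝 (∫ x, f x ∂(gaussianReal 0 (Real.toNNReal
            (c ⬝ᵥ (Matrix.of
              ((Fin.cons
                (Fin.cons (VstarTheta T 𝒢 a p Sstar Sthetastar)
                  (VstarXtheta T M 𝒢 a b p Sstar))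
                (fun j => Fin.cons (VstarXtheta T M 𝒢 a b p Sstar j)
                  (fun k => VstarX T M 𝒢 b p Sstar j k)))
                : Fin (M + 1) → Fin (M + 1) → ℝ)).mulVec c))))) := by
  set Sth : ℝ := ∑ p ∈ 𝒢 ×ˢ (Finset.univ : Finset (Fin T)),
      ∑ q ∈ 𝒢 ×ˢ (Finset.univ : Finset (Fin T)),
        Atheta T 𝒢 a p.1 p.2 * Atheta T 𝒢 a q.1 q.2 * SstarCross p.1 q.1 p.2 q.2 with hSth
  have hStheta : Tendsto (fun m => Stheta (N m) T 𝒢 (Y m) a) atTop (𝓝 Sth) := by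
    simp_rw [Stheta_quad]
    refine tendsto_finsetSum _ fun p hp => tendsto_finsetSum _ fun q hq => ?_
    exact (hScross p.1 (Finset.mem_product.1 hp).1 q.1 (Finset.mem_product.1 hq).1
      p.2 q.2).const_mul _
  refine ⟨Sth, hStheta, fun c f hf hfb => ?_⟩
  have hsym : ∀ g ∈ 𝒢, (Sstar g)ᵀ = Sstar g := fun g hg => by
    have := (hSpd g hg).isHermitian.eq
    rwa [Matrix.conjTranspose_eq_transpose_of_trivial] at this
  rw [← limit_var 𝒢 a b p Sstar hsym Sth c]
  have hNinv : Tendsto (fun m => ((N m : ℕ) : ℝ)⁻¹) atTop (𝓝 0) :=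
    tendsto_inv_atTop_zero.comp (tendsto_natCast_atTop_atTop.comp hNtop)
  have hσ : Tendsto (fun m => (∑ i, ∑ g : 𝒢, (Ng m g : ℝ) *
      bb 𝒢 (Ng m) (Y m) (wt 𝒢 a b c) i g ^ 2) / (N m : ℝ)) atTop
      (𝓝 (∑ g ∈ 𝒢, (p g)⁻¹ * (wt 𝒢 a b c g ⬝ᵥ (Sstar g).mulVec (wt 𝒢 a b c g))
        - c 0 ^ 2 * Sth)) := by
    simp_rw [fun m => bb_var (hN2 m) 𝒢 (Ng m) (hNg m) (hsum m) (Y m) a b (hNA m) hb c]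
    have h1 : Tendsto (fun m => 1 - ((N m : ℕ) : ℝ)⁻¹) atTop (𝓝 1) := by
      simpa using hNinv.const_sub 1
    have h2 : Tendsto (fun m => ∑ g ∈ 𝒢, ((Ng m g : ℝ) / N m)⁻¹ *
          (wt 𝒢 a b c g ⬝ᵥ (Sg (N m) T (Y m) g).mulVec (wt 𝒢 a b c g))
          - c 0 ^ 2 * Stheta (N m) T 𝒢 (Y m) a) atTop
        (𝓝 (∑ g ∈ 𝒢, (p g)⁻¹ * (wt 𝒢 a b c g ⬝ᵥ (Sstar g).mulVec (wt 𝒢 a b c g))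
        - c 0 ^ 2 * Sth)) := by
      refine Tendsto.sub (tendsto_finsetSum _ fun g hg => ?_) (hStheta.const_mul _)
      refine ((hpconv g hg).inv₀ (hp g hg).1.ne').mul ?_
      simp only [dotProduct, mulVec]
      refine tendsto_finsetSum _ fun t _ => Tendsto.const_mul _ ?_
      exact tendsto_finsetSum _ fun t' _ => (hSconv g hg t t').mul_const _
    simpa using h1.mul h2
  have hclt := (combCLT N hN2 hNtop (fun m => assigns (N m) 𝒢 (Ng m))
    (fun m (g : 𝒢) => (Ng m g : ℝ)) (fun m => assigns_swapInv (N m) 𝒢 (Ng m) (hsum m))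
    (fun m => bb 𝒢 (Ng m) (Y m) (wt 𝒢 a b c))
    (fun m i => bb_row (hN2 m) 𝒢 (Ng m) (hNg m) (hsum m) (Y m) _ i)
    (fun m g => bb_col (hN2 m) 𝒢 (Ng m) (Y m) _ g)
    (fun ε hε => bb_small 𝒢 N Ng Y _ p hN2 hp hpconv hLind ε hε) _ hσ f hf hfb).2
  refine hclt.congr fun m => ?_
  unfold expec
  congr 1
  refine Finset.sum_congr rfl fun d hd => ?_
  beta_reduce
  rw [stat_eq (hN2 m) 𝒢 (Ng m) (hNg m) (Y m) a b (hNA m) hb c d hd]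

end Staggered
end
end

section
/- (Lemma A2, consistency of the within-cohort sample covariance.) Under Assumptions 1 and 3, for every g ∈ 𝒢, the sample covariance Ŝ_g := (N_g − 1)^{-1} Σ_{i=1}^N D_{ig} (Y_i − Ȳ_g)(Y_i − Ȳ_g)′ converges in probability to S*_g: for every ε > 0, P(‖Ŝ_g − S*_g‖ > ε) → 0 along the sequence of populations. -/
open Finset Filter Topology Matrix MeasureTheory ProbabilityTheory
open scoped BigOperators Classical ENNReal NNReal

noncomputable section

namespace Staggered

lemma assigns_perm (N : ℕ) (𝒢 : Finset Date) (Ng : Date → ℕ) (σ : Equiv.Perm (Fin N))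
    (f : (Fin N → 𝒢) → ℝ) :
    ∑ d ∈ assigns N 𝒢 Ng, f (fun i => d (σ i)) = ∑ d ∈ assigns N 𝒢 Ng, f d := by
  have key : ∀ (τ : Equiv.Perm (Fin N)) (d : Fin N → 𝒢), d ∈ assigns N 𝒢 Ng →
      (fun i => d (τ i)) ∈ assigns N 𝒢 Ng := by
    intro τ d hd
    simp only [assigns, Finset.mem_filter, Finset.mem_univ, true_and] at hd ⊢
    intro g hg
    rw [← hd g hg]
    refine Finset.card_bij (fun i _ => τ i) ?_ ?_ ?_
    · intro i hi
      simpa using hi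
    · intro i _ j _ h
      exact τ.injective h
    · intro j hj
      refine ⟨τ.symm j, ?_, by simp⟩
      simpa using hj
  refine Finset.sum_bij' (fun d _ => fun i => d (σ i)) (fun d _ => fun i => d (σ.symm i)) ?_ ?_ ?_ ?_ ?_
  · intro d hd; exact key σ d hd
  · intro d hd; exact key σ.symm d hd
  · intro d _; funext i; simp
  · intro d _; funext i; simp
  · intro d _; rfl

/-- Indicator. -/
def ind {N : ℕ} {𝒢 : Finset Date} (g : Date) (d : Fin N → 𝒢) (i : Fin N) : ℝ :=
  if (d i : Date) = g then 1 else 0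

lemma ind_sum {N : ℕ} {𝒢 : Finset Date} {Ng : Date → ℕ} {g : Date} (hg : g ∈ 𝒢)
    {d : Fin N → 𝒢} (hd : d ∈ assigns N 𝒢 Ng) : ∑ i, ind g d i = (Ng g : ℝ) := by
  simp only [assigns, Finset.mem_filter, Finset.mem_univ, true_and] at hd
  rw [← hd g hg]
  simp [ind]

lemma var_bound (N : ℕ) (𝒢 : Finset Date) (Ng : Date → ℕ) (g : Date) (hg : g ∈ 𝒢)
    (hN : 2 ≤ N) (x : Fin N → ℝ) (hx : ∑ i, x i = 0) :
    ∑ d ∈ assigns N 𝒢 Ng, (∑ i, ind g d i * x i) ^ 2 ≤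
      ((assigns N 𝒢 Ng).card : ℝ) * ((Ng g : ℝ) / N * ∑ i, x i ^ 2) := by
  set A := assigns N 𝒢 Ng with hA
  let M : Fin N → Fin N → ℝ := fun i j => ∑ d ∈ A, ind g d i * ind g d j
  have hM : ∀ (σ : Equiv.Perm (Fin N)) i j, M (σ i) (σ j) = M i j := by
    intro σ i j
    exact assigns_perm N 𝒢 Ng σ (fun d => ind g d i * ind g d j)
  let i0 : Fin N := ⟨0, by omega⟩
  let i1 : Fin N := ⟨1, by omega⟩
  have h01 : i0 ≠ i1 := by simp [i0, i1]
  have hdiag : ∀ i, M i i = M i0 i0 := by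
    intro i
    have := hM (Equiv.swap i0 i) i0 i0
    simpa using this
  have hoff : ∀ i j, i ≠ j → M i j = M i0 i1 := by
    intro k l hkl
    have h := hM (Equiv.swap (Equiv.swap i0 k i1) l * Equiv.swap i0 k) i0 i1
    have e1 : (Equiv.swap (Equiv.swap i0 k i1) l * Equiv.swap i0 k) i0 = k := by
      simp only [Equiv.Perm.mul_apply, Equiv.swap_apply_left]
      apply Equiv.swap_apply_of_ne_of_ne _ hkl
      intro h
      have : Equiv.swap i0 k i0 = Equiv.swap i0 k i1 := by simpa using h
      exact h01 ((Equiv.swap i0 k).injective this)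
    have e2 : (Equiv.swap (Equiv.swap i0 k i1) l * Equiv.swap i0 k) i1 = l := by
      simp
    rw [e1, e2] at h
    exact h
  have hc : 0 ≤ M i0 i1 := by
    refine Finset.sum_nonneg fun d _ => ?_
    unfold ind
    split_ifs <;> simp
  have hNpos : (0 : ℝ) < N := by exact_mod_cast (by omega : 0 < N)
  have ha : M i0 i0 = (A.card : ℝ) * ((Ng g : ℝ) / N) := by
    have h1 : ∑ i, M i i = (A.card : ℝ) * Ng g := by
      simp only [M]
      rw [Finset.sum_comm]
      rw [Finset.sum_congr rfl (g := fun _ => (Ng g : ℝ))]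
      · simp
      · intro d hd
        rw [← ind_sum hg hd]
        refine Finset.sum_congr rfl fun i _ => ?_
        unfold ind
        split_ifs <;> simp
    rw [Finset.sum_congr rfl (fun i _ => hdiag i)] at h1
    simp only [Finset.sum_const, Finset.card_univ, Fintype.card_fin, nsmul_eq_mul] at h1
    field_simp
    linarith
  have hMeq : ∀ i j, M i j = M i0 i1 + (if i = j then M i0 i0 - M i0 i1 else 0) := by
    intro i j
    split_ifs with h
    · subst h; rw [hdiag]; ring
    · rw [hoff i j h]; ring
  have hexp : ∑ d ∈ A, (∑ i, ind g d i * x i) ^ 2 = ∑ i, ∑ j, x i * x j * M i j := by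
    have e : ∀ d : Fin N → 𝒢, (∑ i, ind g d i * x i) ^ 2 =
        ∑ i, ∑ j, x i * x j * (ind g d i * ind g d j) := by
      intro d
      rw [sq, Finset.sum_mul_sum]
      refine Finset.sum_congr rfl fun i _ => Finset.sum_congr rfl fun j _ => ?_
      ring
    simp only [e]
    rw [Finset.sum_comm]
    refine Finset.sum_congr rfl fun i _ => ?_
    rw [Finset.sum_comm]
    refine Finset.sum_congr rfl fun j _ => ?_
    rw [Finset.mul_sum]
  have h2 : ∑ i, ∑ j, x i * x j * M i j = (M i0 i0 - M i0 i1) * ∑ i, x i ^ 2 := by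
    have : ∀ i, ∑ j, x i * x j * M i j = (M i0 i0 - M i0 i1) * x i ^ 2 := by
      intro i
      simp_rw [hMeq i, mul_add, Finset.sum_add_distrib]
      have : ∑ j, x i * x j * M i0 i1 = x i * M i0 i1 * ∑ j, x j := by
        rw [Finset.mul_sum]; refine Finset.sum_congr rfl fun j _ => by ring
      rw [this, hx]
      simp
      ring
    simp_rw [this]
    rw [Finset.mul_sum]
  rw [hexp, h2, ← mul_assoc, ← ha]
  have : 0 ≤ ∑ i, x i ^ 2 := Finset.sum_nonneg fun i _ => sq_nonneg _
  nlinarith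

/-- Convergence in probability to a constant. -/
def TP (𝒢 : Finset Date) (N : ℕ → ℕ) (Ng : ℕ → Date → ℕ)
    (X : ∀ m, (Fin (N m) → 𝒢) → ℝ) (c : ℝ) : Prop :=
  ∀ ε > (0 : ℝ), Tendsto (fun m => prob (N m) 𝒢 (Ng m) fun d => ε < |X m d - c|) atTop (𝓝 0)

lemma prob_nonneg (N : ℕ) (𝒢 : Finset Date) (Ng : Date → ℕ) (p : (Fin N → 𝒢) → Prop) :
    0 ≤ prob N 𝒢 Ng p := by
  unfold prob; positivity

lemma TP_of_L2 (𝒢 : Finset Date) (N : ℕ → ℕ) (Ng : ℕ → Date → ℕ)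
    (X : ∀ m, (Fin (N m) → 𝒢) → ℝ) (c : ℝ) (cm v : ℕ → ℝ)
    (hc : Tendsto cm atTop (𝓝 c)) (hv : Tendsto v atTop (𝓝 0))
    (h : ∀ᶠ m in atTop, ∑ d ∈ assigns (N m) 𝒢 (Ng m), (X m d - cm m) ^ 2 ≤
      ((assigns (N m) 𝒢 (Ng m)).card : ℝ) * v m) : TP 𝒢 N Ng X c := by
  intro ε hε
  have hlim : Tendsto (fun m => |v m| / (ε / 2) ^ 2) atTop (𝓝 0) := by
    have := (hv.abs).div_const ((ε / 2) ^ 2)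
    simpa using this
  refine tendsto_of_tendsto_of_tendsto_of_le_of_le' tendsto_const_nhds hlim
    (Eventually.of_forall fun m => prob_nonneg _ _ _ _) ?_
  have hc' : ∀ᶠ m in atTop, |cm m - c| < ε / 2 := by
    have := (Metric.tendsto_nhds.1 hc) (ε / 2) (by positivity)
    simpa [Real.dist_eq] using this
  filter_upwards [h, hc'] with m hm hcm
  set A := assigns (N m) 𝒢 (Ng m) with hA
  unfold prob
  rw [← hA]
  by_cases hA0 : A.card = 0
  · rw [hA0]; simp; positivity
  have hApos : (0 : ℝ) < A.card := by exact_mod_cast Nat.pos_of_ne_zero hA0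
  rw [div_le_div_iff₀ hApos (by positivity)]
  have h1 : ((A.filter fun d => ε < |X m d - c|).card : ℝ) * (ε / 2) ^ 2 ≤
      ∑ d ∈ A.filter (fun d => ε < |X m d - c|), (X m d - cm m) ^ 2 := by
    rw [← nsmul_eq_mul]
    refine Finset.card_nsmul_le_sum _ _ _ fun d hd => ?_
    have hd' := (Finset.mem_filter.1 hd).2
    have h3 : ε / 2 ≤ |X m d - cm m| := by
      have := abs_add_le (X m d - cm m) (cm m - c)
      have e : X m d - cm m + (cm m - c) = X m d - c := by ring
      rw [e] at this
      linarith
    rw [← sq_abs (X m d - cm m)]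
    gcongr
  have h2 : ∑ d ∈ A.filter (fun d => ε < |X m d - c|), (X m d - cm m) ^ 2 ≤
      ∑ d ∈ A, (X m d - cm m) ^ 2 :=
    Finset.sum_le_sum_of_subset_of_nonneg (Finset.filter_subset _ _) fun _ _ _ => sq_nonneg _
  have h4 : (A.card : ℝ) * v m ≤ A.card * |v m| := by gcongr; exact le_abs_self _
  linarith

lemma TP_cont {κ : Type} [Fintype κ] (𝒢 : Finset Date) (N : ℕ → ℕ) (Ng : ℕ → Date → ℕ)
    (X : κ → ∀ m, (Fin (N m) → 𝒢) → ℝ) (c : κ → ℝ) (hX : ∀ k, TP 𝒢 N Ng (X k) (c k))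
    (F : (κ → ℝ) → ℝ) (hF : Continuous F) (Z : ∀ m, (Fin (N m) → 𝒢) → ℝ)
    (hZ : ∀ m, ∀ d ∈ assigns (N m) 𝒢 (Ng m), Z m d = F fun k => X k m d) :
    TP 𝒢 N Ng Z (F c) := by
  intro ε hε
  obtain ⟨δ, hδ, hball⟩ := Metric.continuousAt_iff.1 (hF.continuousAt (x := c)) ε hε
  have hlim : Tendsto (fun m => ∑ k, prob (N m) 𝒢 (Ng m) fun d => δ / 2 < |X k m d - c k|)
      atTop (𝓝 0) := by
    have := tendsto_finsetSum (Finset.univ : Finset κ)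
      (fun k _ => hX k (δ / 2) (by positivity))
    simpa using this
  refine tendsto_of_tendsto_of_tendsto_of_le_of_le tendsto_const_nhds hlim
    (fun m => prob_nonneg _ _ _ _) fun m => ?_
  simp only [prob]
  rw [← Finset.sum_div]
  gcongr
  rw [← Nat.cast_sum]
  norm_cast
  refine le_trans (Finset.card_le_card ?_) (Finset.card_biUnion_le)
  intro d hd
  obtain ⟨hdA, hd⟩ := Finset.mem_filter.1 hd
  rw [Finset.mem_biUnion]
  by_contra hcon
  push Not at hcon
  have : dist (fun k => X k m d) c < δ := by
    rw [dist_pi_lt_iff hδ]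
    intro k
    have := hcon k (Finset.mem_univ k)
    rw [Finset.mem_filter] at this
    have h2 : |X k m d - c k| ≤ δ / 2 := by
      by_contra h
      exact this ⟨hdA, not_le.1 h⟩
    rw [Real.dist_eq]
    linarith
  have := hball this
  rw [Real.dist_eq, ← hZ m d hdA] at this
  linarith

/-- Convergence of cohort averages of a scalar attribute. -/
lemma TP_mean (𝒢 : Finset Date) (N : ℕ → ℕ) (Ng : ℕ → Date → ℕ) (g : Date) (hg : g ∈ 𝒢)
    (hN : ∀ m, 2 ≤ N m) (hNg : ∀ m, 1 ≤ Ng m g) (z : ∀ m, Fin (N m) → ℝ) (c : ℝ) (v : ℕ → ℝ)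
    (hc : Tendsto (fun m => (∑ i, z m i) / (N m : ℝ)) atTop (𝓝 c))
    (hv : Tendsto v atTop (𝓝 0))
    (h : ∀ᶠ m in atTop, (∑ i, z m i ^ 2) / ((Ng m g : ℝ) * N m) ≤ v m) :
    TP 𝒢 N Ng (fun m d => (∑ i, ind g d i * z m i) / (Ng m g : ℝ)) c := by
  refine TP_of_L2 𝒢 N Ng _ c (fun m => (∑ i, z m i) / (N m : ℝ)) v hc hv ?_
  filter_upwards [h] with m hm
  have hNpos : (0 : ℝ) < N m := by have := hN m; exact_mod_cast (by omega : 0 < N m)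
  have hnpos : (0 : ℝ) < Ng m g := by exact_mod_cast hNg m
  set μ := (∑ i, z m i) / (N m : ℝ) with hμ
  have hμ' : ∑ i, z m i = N m * μ := by rw [hμ]; field_simp
  have hx : ∑ i, (z m i - μ) = 0 := by
    rw [Finset.sum_sub_distrib, hμ']; simp
  have hvb := var_bound (N m) 𝒢 (Ng m) g hg (hN m) (fun i => z m i - μ) hx
  have hsq : ∑ i, (z m i - μ) ^ 2 ≤ ∑ i, z m i ^ 2 := by
    have : ∑ i, (z m i - μ) ^ 2 = ∑ i, z m i ^ 2 - N m * μ ^ 2 := by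
      have e : ∀ i, (z m i - μ) ^ 2 = z m i ^ 2 - (2 * μ) * z m i + μ ^ 2 := fun i => by ring
      simp_rw [e, Finset.sum_add_distrib, Finset.sum_sub_distrib, ← Finset.mul_sum, hμ']
      simp; ring
    rw [this]
    have : 0 ≤ N m * μ ^ 2 := by positivity
    linarith
  have heq : ∀ d ∈ assigns (N m) 𝒢 (Ng m),
      ((∑ i, ind g d i * z m i) / (Ng m g : ℝ) - μ) ^ 2 =
        (∑ i, ind g d i * (z m i - μ)) ^ 2 / (Ng m g : ℝ) ^ 2 := by
    intro d hd
    have : ∑ i, ind g d i * (z m i - μ) = ∑ i, ind g d i * z m i - Ng m g * μ := by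
      simp_rw [mul_sub, Finset.sum_sub_distrib, ← Finset.sum_mul, ind_sum hg hd]
    rw [this]; field_simp
  rw [Finset.sum_congr rfl heq, ← Finset.sum_div, div_le_iff₀ (by positivity)]
  refine hvb.trans ?_
  rw [mul_assoc]
  refine mul_le_mul_of_nonneg_left ?_ (Nat.cast_nonneg _)
  rw [div_le_iff₀ (by positivity)] at hm
  calc (Ng m g : ℝ) / N m * ∑ i, (z m i - μ) ^ 2
      ≤ (Ng m g : ℝ) / N m * (v m * ((Ng m g : ℝ) * N m)) := by
        gcongr; exact hsq.trans hm
    _ = _ := by field_simp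

lemma shat_eq {N T : ℕ} {𝒢 : Finset Date} {Ng : Date → ℕ} {g : Date} (hg : g ∈ 𝒢)
    (hn : 1 ≤ Ng g) (Y : Fin N → Date → Fin T → ℝ) (μ : Fin T → ℝ)
    {d : Fin N → 𝒢} (hd : d ∈ assigns N 𝒢 Ng) (t t' : Fin T) :
    Shat Ng (obs Y d) d g t t' = ((Ng g : ℝ) / (Ng g - 1)) *
      ((∑ i, ind g d i * ((Y i g t - μ t) * (Y i g t' - μ t'))) / Ng g -
        (∑ i, ind g d i * (Y i g t - μ t)) / Ng g *
          ((∑ i, ind g d i * (Y i g t' - μ t')) / Ng g)) := by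
  have hnpos : (0 : ℝ) < Ng g := by exact_mod_cast hn
  have hs := ind_sum hg hd
  have hcm : ∀ s, cmean Ng (obs Y d) d g s = μ s + (∑ i, ind g d i * (Y i g s - μ s)) / Ng g := by
    intro s
    have : ∑ i, ind g d i * (Y i g s - μ s) = ∑ i, ind g d i * Y i g s - Ng g * μ s := by
      simp_rw [mul_sub, Finset.sum_sub_distrib, ← Finset.sum_mul, hs]
    rw [this]
    unfold cmean
    have h2 : (∑ i, if (d i : Date) = g then obs Y d i s else 0) = ∑ i, ind g d i * Y i g s := by
      refine Finset.sum_congr rfl fun i _ => ?_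
      unfold ind obs
      split_ifs with h
      · rw [h]; ring
      · ring
    rw [h2]; field_simp; ring
  simp only [Shat, Matrix.of_apply, hcm]
  set a := (∑ i, ind g d i * (Y i g t - μ t)) / (Ng g : ℝ) with ha
  set b := (∑ i, ind g d i * (Y i g t' - μ t')) / (Ng g : ℝ) with hb
  have ha' : ∑ i, ind g d i * (Y i g t - μ t) = Ng g * a := by rw [ha]; field_simp
  have hb' : ∑ i, ind g d i * (Y i g t' - μ t') = Ng g * b := by rw [hb]; field_simp
  have h3 : (∑ i, if (d i : Date) = g then (obs Y d i t - (μ t + a)) * (obs Y d i t' - (μ t' + b))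
      else 0) = ∑ i, ind g d i * ((Y i g t - μ t) * (Y i g t' - μ t')) - Ng g * (a * b) := by
    have : ∀ i, (if (d i : Date) = g then
        (obs Y d i t - (μ t + a)) * (obs Y d i t' - (μ t' + b)) else 0) =
        ind g d i * ((Y i g t - μ t) * (Y i g t' - μ t')) - (ind g d i * (Y i g t - μ t)) * b
          - (ind g d i * (Y i g t' - μ t')) * a + ind g d i * (a * b) := by
      intro i
      unfold ind obs
      split_ifs with h
      · rw [h]; ring
      · ring
    simp_rw [this, Finset.sum_add_distrib, Finset.sum_sub_distrib, ← Finset.sum_mul, ha', hb', hs]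
    ring
  rw [h3]
  field_simp

/-- **Lemma A2.** Under Assumptions 1 and 3, the within-cohort sample
covariance `Ŝ_g` converges in probability to `S*_g`: for every `ε > 0`,
`P(‖Ŝ_g - S*_g‖ > ε) → 0` (Frobenius norm). -/
theorem statement10
    (T : ℕ) (𝒢 : Finset Date) (N : ℕ → ℕ) (Ng : ℕ → Date → ℕ)
    (Y : ∀ m, Fin (N m) → Date → Fin T → ℝ)
    (p : Date → ℝ) (Sstar : Date → Matrix (Fin T) (Fin T) ℝ)
    (SstarCross : Date → Date → Matrix (Fin T) (Fin T) ℝ)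
    (hN2 : ∀ m, 2 ≤ N m) (hNtop : Tendsto N atTop atTop)
    (h𝒢ne : 𝒢.Nonempty) (h𝒢 : ∀ g ∈ 𝒢, (1 ≤ g ∧ g ≤ (T : Date)) ∨ g = ⊤)
    (hNg : ∀ m, ∀ g ∈ 𝒢, 1 ≤ Ng m g) (hsum : ∀ m, ∑ g ∈ 𝒢, Ng m g = N m)
    (hp : ∀ g ∈ 𝒢, 0 < p g ∧ p g < 1)
    (hpconv : ∀ g ∈ 𝒢, Tendsto (fun m => (Ng m g : ℝ) / (N m : ℝ)) atTop (𝓝 (p g)))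
    (hSconv : ∀ g ∈ 𝒢, ∀ t t' : Fin T,
      Tendsto (fun m => Sg (N m) T (Y m) g t t') atTop (𝓝 (Sstar g t t')))
    (hScross : ∀ g ∈ 𝒢, ∀ g' ∈ 𝒢, ∀ t t' : Fin T,
      Tendsto (fun m => Sgg (N m) T (Y m) g g' t t') atTop (𝓝 (SstarCross g g' t t')))
    (hSpd : ∀ g ∈ 𝒢, (Sstar g).PosDef)
    (hLind : ∀ ε > (0 : ℝ), ∀ᶠ m in atTop, ∀ (i : Fin (N m)), ∀ g ∈ 𝒢,
      (∑ t, (Y m i g t - popMeanS (N m) fun i' => Y m i' g t) ^ 2) / (N m : ℝ) < ε) :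
    ∀ g ∈ 𝒢, ∀ ε > (0 : ℝ),
      Tendsto (fun m => prob (N m) 𝒢 (Ng m) fun d =>
          ε < Real.sqrt (∑ t, ∑ t',
            (Shat (Ng m) (obs (Y m) d) d g t t' - Sstar g t t') ^ 2))
        atTop (𝓝 0) := by
  intro g hg ε hε
  have hNR : Tendsto (fun m => (N m : ℝ)) atTop atTop := tendsto_natCast_atTop_atTop.comp hNtop
  have hNpos : ∀ m, (0 : ℝ) < N m := fun m => by have := hN2 m; exact_mod_cast (by omega : 0 < N m)
  have hN1 : ∀ m, (0 : ℝ) < (N m : ℝ) - 1 := fun m => by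
    have : (2 : ℝ) ≤ N m := by exact_mod_cast hN2 m
    linarith
  have hnpos : ∀ m, (0 : ℝ) < Ng m g := fun m => by exact_mod_cast hNg m g hg
  have hpg := (hp g hg).1
  have hninv : Tendsto (fun m => ((Ng m g : ℝ))⁻¹) atTop (𝓝 0) := by
    have h1 := ((hpconv g hg).inv₀ hpg.ne').mul hNR.inv_tendsto_atTop
    rw [mul_zero] at h1
    refine h1.congr fun m => ?_
    have := hNpos m; have := hnpos m
    simp only [Pi.inv_apply]
    field_simp
  have hr : Tendsto (fun m => (Ng m g : ℝ) / (Ng m g - 1)) atTop (𝓝 1) := by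
    have h1 : Tendsto (fun m => (1 - ((Ng m g : ℝ))⁻¹)⁻¹) atTop (𝓝 1) := by
      have := (hninv.const_sub 1).inv₀ (by norm_num)
      simpa using this
    refine h1.congr fun m => ?_
    have := hnpos m
    rw [← inv_div]
    congr 1
    field_simp
  have hfac : Tendsto (fun m => ((N m : ℝ) - 1) / N m) atTop (𝓝 1) := by
    have h1 : Tendsto (fun m => 1 - ((N m : ℝ))⁻¹) atTop (𝓝 1) := by
      simpa using hNR.inv_tendsto_atTop.const_sub 1
    refine h1.congr fun m => ?_
    have := hNpos m
    field_simp
  let μ : ∀ m, Fin T → ℝ := fun m t => popMeanS (N m) fun i' => Y m i' g t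
  let w : ∀ m, Fin (N m) → Fin T → ℝ := fun m i t => Y m i g t - μ m t
  have hSg : ∀ m t t', ∑ i, w m i t * w m i t' = ((N m : ℝ) - 1) * Sg (N m) T (Y m) g t t' := by
    intro m t t'
    have := hN1 m
    simp only [Sg, popCov, Matrix.of_apply]
    rw [mul_div_cancel₀ _ this.ne']
    rfl
  have hw0 : ∀ m t, ∑ i, w m i t = 0 := by
    intro m t
    have := hNpos m
    simp only [w, μ, popMeanS, Finset.sum_sub_distrib, Finset.sum_const, Finset.card_univ,
      Fintype.card_fin, nsmul_eq_mul]
    field_simp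
    simp
  -- first moments
  have hW : ∀ t, TP 𝒢 N Ng (fun m d => (∑ i, ind g d i * w m i t) / (Ng m g : ℝ)) 0 := by
    intro t
    refine TP_mean 𝒢 N Ng g hg hN2 (fun m => hNg m g hg) (fun m i => w m i t) 0
      (fun m => ((N m : ℝ) - 1) / N m * Sg (N m) T (Y m) g t t * ((Ng m g : ℝ))⁻¹) ?_ ?_ ?_
    · simp [hw0]
    · simpa using (hfac.mul (hSconv g hg t t)).mul hninv
    · refine Eventually.of_forall fun m => le_of_eq ?_
      simp only [sq, hSg]
      have := hNpos m; have := hnpos m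
      field_simp
  have hZ : ∀ t t', TP 𝒢 N Ng
      (fun m d => (∑ i, ind g d i * (w m i t * w m i t')) / (Ng m g : ℝ)) (Sstar g t t') := by
    intro t t'
    let mx : ℕ → ℝ := fun m => ⨆ i, (∑ s, (w m i s) ^ 2) / (N m : ℝ)
    have hmx : Tendsto mx atTop (𝓝 0) := by
      rw [Metric.tendsto_nhds]
      intro δ hδ
      filter_upwards [hLind (δ / 2) (by positivity)] with m hm
      have : Nonempty (Fin (N m)) := ⟨⟨0, by have := hN2 m; omega⟩⟩
      have h1 : mx m ≤ δ / 2 := ciSup_le fun i => (hm i g hg).le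
      have h0 : 0 ≤ mx m := Real.iSup_nonneg fun i => by
        have := hNpos m; positivity
      rw [Real.dist_eq, sub_zero, abs_of_nonneg h0]
      linarith
    have hle : ∀ m i s, w m i s ^ 2 ≤ mx m * N m := by
      intro m i s
      rw [← div_le_iff₀ (hNpos m)]
      refine le_trans ?_ (le_ciSup (f := fun i => (∑ s, (w m i s) ^ 2) / (N m : ℝ))
        (Set.finite_range _).bddAbove i)
      have := hNpos m
      gcongr
      exact Finset.single_le_sum (f := fun s => w m i s ^ 2) (fun _ _ => sq_nonneg _)
        (Finset.mem_univ s)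
    refine TP_mean 𝒢 N Ng g hg hN2 (fun m => hNg m g hg) (fun m i => w m i t * w m i t') _
      (fun m => mx m * (((N m : ℝ) - 1) / N m * Sg (N m) T (Y m) g t' t') *
        ((Ng m g : ℝ) / N m)⁻¹) ?_ ?_ ?_
    · have := hfac.mul (hSconv g hg t t')
      rw [one_mul] at this
      refine this.congr fun m => ?_
      rw [hSg]; ring
    · simpa using (hmx.mul (hfac.mul (hSconv g hg t' t'))).mul ((hpconv g hg).inv₀ hpg.ne')
    · refine Eventually.of_forall fun m => ?_
      have := hNpos m; have := hnpos m
      rw [div_le_iff₀ (by positivity)]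
      calc ∑ i, (w m i t * w m i t') ^ 2 ≤ ∑ i, (mx m * N m) * (w m i t' * w m i t') := by
            refine Finset.sum_le_sum fun i _ => ?_
            rw [mul_pow, sq (w m i t')]
            gcongr
            · exact mul_self_nonneg _
            · exact hle m i t
        _ = _ := by
            rw [← Finset.mul_sum, hSg]
            field_simp
  have hR : TP 𝒢 N Ng (fun m _ => (Ng m g : ℝ) / (Ng m g - 1)) 1 := by
    refine TP_of_L2 𝒢 N Ng _ 1 (fun m => (Ng m g : ℝ) / (Ng m g - 1)) (fun _ => 0) hr
      tendsto_const_nhds ?_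
    simp
  let X : ((Fin T × Fin T) ⊕ Fin T ⊕ Unit) → ∀ m, (Fin (N m) → 𝒢) → ℝ := fun k =>
    match k with
    | Sum.inl q => fun m d => (∑ i, ind g d i * (w m i q.1 * w m i q.2)) / (Ng m g : ℝ)
    | Sum.inr (Sum.inl t) => fun m d => (∑ i, ind g d i * w m i t) / (Ng m g : ℝ)
    | Sum.inr (Sum.inr _) => fun m _ => (Ng m g : ℝ) / (Ng m g - 1)
  let c : ((Fin T × Fin T) ⊕ Fin T ⊕ Unit) → ℝ := fun k =>
    match k with
    | Sum.inl q => Sstar g q.1 q.2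
    | Sum.inr (Sum.inl _) => 0
    | Sum.inr (Sum.inr _) => 1
  let F : (((Fin T × Fin T) ⊕ Fin T ⊕ Unit) → ℝ) → ℝ := fun x =>
    Real.sqrt (∑ t, ∑ t', (x (Sum.inr (Sum.inr ())) * (x (Sum.inl (t, t')) -
      x (Sum.inr (Sum.inl t)) * x (Sum.inr (Sum.inl t'))) - Sstar g t t') ^ 2)
  have hX : ∀ k, TP 𝒢 N Ng (X k) (c k) := by
    rintro (⟨t, t'⟩ | t | _)
    · exact hZ t t'
    · exact hW t
    · exact hR
  have hF : Continuous F := by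
    simp only [F]
    fun_prop
  have hFc : F c = 0 := by simp [F, c]
  have hfin := TP_cont 𝒢 N Ng X c hX F hF
    (fun m d => Real.sqrt (∑ t, ∑ t',
            (Shat (Ng m) (obs (Y m) d) d g t t' - Sstar g t t') ^ 2)) (by
      intro m d hd
      simp only [F, X]
      congr 1
      refine Finset.sum_congr rfl fun t _ => Finset.sum_congr rfl fun t' _ => ?_
      rw [shat_eq hg (hNg m g hg) (Y m) (μ m) hd t t']) ε hε
  rw [hFc] at hfin
  simpa only [sub_zero, abs_of_nonneg (Real.sqrt_nonneg _)] using hfin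

end Staggered
end
end
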